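/- arXiv:2509.26338 — 2 statements merged into one kernel-verified Lean document; each statement's English description precedes it below -/
import Mathlib

section
/- Let μ be a Carleson measure on 𝔻. Given ε > 0, let A(ε) be the collection of Carleson squares Q with μ(Q) ≥ ε ℓ(Q). Let E ∈ VMOA be such that |E|μ (given by d(|E|μ)(z) = |E(z)| dμ(z)) is a vanishing Carleson measure. Then |E(z_Q)| → 0 as ℓ(Q) → 0 over Q ∈ A(ε), where for a Carleson square Q = Q(I) with I an arc centered at ξ ∈ ∂𝔻 one sets z_Q = (1 − ℓ(Q))ξ. -/
open MeasureTheory Filter Set Topology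

noncomputable section

/-- The open unit disc in `ℂ`. -/
def unitDisc : Set ℂ := {z : ℂ | ‖z‖ < 1}

/-- The point `e^{iθ}` on the unit circle. -/
def circlePt (θ : ℝ) : ℂ := Complex.exp ((θ : ℂ) * Complex.I)

/-- The Carleson square based on the arc centered at `e^{iθ₀}` of normalized length `t`. -/
def carlesonSquare (θ₀ t : ℝ) : Set ℂ :=
  {z : ℂ | z ∈ unitDisc ∧ 1 - t ≤ ‖z‖ ∧
    ∃ θ : ℝ, |θ - θ₀| ≤ Real.pi * t ∧ z = (‖z‖ : ℂ) * circlePt θ}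

/-- `μ` is a Carleson measure. -/
def IsCarleson (μ : Measure ℂ) : Prop :=
  ∃ C : ℝ, 0 < C ∧ ∀ θ₀ t : ℝ, 0 < t → t ≤ 1 →
    μ (carlesonSquare θ₀ t) ≤ ENNReal.ofReal (C * t)

/-- `μ` is a vanishing Carleson measure. -/
def IsVanishingCarleson (μ : Measure ℂ) : Prop :=
  IsCarleson μ ∧ ∀ ε : ℝ, 0 < ε → ∃ δ : ℝ, 0 < δ ∧ ∀ θ₀ t : ℝ, 0 < t → t < δ →
    μ (carlesonSquare θ₀ t) ≤ ENNReal.ofReal (ε * t)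

/-- The measure `|E| μ`, i.e. `d(|E|μ)(z) = |E(z)| dμ(z)`. -/
def absDensity (E : ℂ → ℂ) (μ : Measure ℂ) : Measure ℂ :=
  μ.withDensity (fun z => ENNReal.ofReal ‖E z‖)

/-- Average of a boundary function (in the angle variable) over the arc
centered at `e^{iθ₀}` of normalized length `t`; `dm = dθ/(2π)`. -/
def arcAvg (f : ℝ → ℂ) (θ₀ t : ℝ) : ℂ :=
  ((2 * Real.pi * t)⁻¹ : ℝ) •
    ∫ θ in Set.Ioo (θ₀ - Real.pi * t) (θ₀ + Real.pi * t), f θ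

/-- Mean oscillation of a boundary function over the arc centered at `e^{iθ₀}`
of normalized length `t`. -/
def meanOsc (f : ℝ → ℂ) (θ₀ t : ℝ) : ℝ :=
  (2 * Real.pi * t)⁻¹ *
    ∫ θ in Set.Ioo (θ₀ - Real.pi * t) (θ₀ + Real.pi * t), ‖f θ - arcAvg f θ₀ t‖

/-- A (2π-periodic, integrable) boundary function has bounded mean oscillation. -/
def IsBMO (f : ℝ → ℂ) : Prop :=
  (∀ θ : ℝ, f (θ + 2 * Real.pi) = f θ) ∧
  IntegrableOn f (Set.Ioc 0 (2 * Real.pi)) ∧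
  ∃ C : ℝ, ∀ θ₀ t : ℝ, 0 < t → t ≤ 1 → meanOsc f θ₀ t ≤ C

/-- A boundary function has vanishing mean oscillation. -/
def IsVMO (f : ℝ → ℂ) : Prop :=
  IsBMO f ∧ ∀ ε : ℝ, 0 < ε → ∃ δ : ℝ, 0 < δ ∧
    ∀ θ₀ t : ℝ, 0 < t → t < δ → meanOsc f θ₀ t ≤ ε

/-- The BMO seminorm of a boundary function. -/
def bmoSeminorm (f : ℝ → ℂ) : ℝ :=
  sSup {c : ℝ | ∃ θ₀ t : ℝ, 0 < t ∧ t ≤ 1 ∧ c = meanOsc f θ₀ t}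

/-- `Fb` is the (a.e.) radial boundary function of `F`. -/
def HasRadialLimits (F : ℂ → ℂ) (Fb : ℝ → ℂ) : Prop :=
  ∀ᵐ θ ∂(volume.restrict (Set.Ioc 0 (2 * Real.pi))),
    Tendsto (fun r : ℝ => F ((r : ℂ) * circlePt θ))
      (nhdsWithin 1 (Set.Iio 1)) (nhds (Fb θ))

/-- `F` is a bounded analytic function on the unit disc. -/
def MemHinf (F : ℂ → ℂ) : Prop :=
  DifferentiableOn ℂ F unitDisc ∧ ∃ M : ℝ, ∀ z ∈ unitDisc, ‖F z‖ ≤ M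

/-- `F` belongs to `QA` with boundary function `Fb`: it is a bounded analytic
function on the disc whose radial boundary values are in VMO. -/
def MemQA (F : ℂ → ℂ) (Fb : ℝ → ℂ) : Prop :=
  MemHinf F ∧ HasRadialLimits F Fb ∧ IsVMO Fb

/-- `E` is an outer function. -/
def IsOuter (E : ℂ → ℂ) : Prop :=
  DifferentiableOn ℂ E unitDisc ∧
  ∃ h : ℝ → ℝ, IntegrableOn h (Set.Ioc 0 (2 * Real.pi)) ∧ ∀ z ∈ unitDisc,
    E z = Complex.exp (((2 * Real.pi)⁻¹ : ℝ) • ∫ θ in Set.Ioc 0 (2 * Real.pi),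
      ((circlePt θ + z) / (circlePt θ - z)) * (h θ : ℂ))

/-- The integral means appearing in the definition of the Hardy space `ℍ^p`. -/
def hardyIntegral (p : ℝ) (F : ℂ → ℂ) (r : ℝ) : ℝ :=
  ∫ θ in Set.Ioc 0 (2 * Real.pi), ‖F ((r : ℂ) * circlePt θ)‖ ^ p

/-- `F` belongs to the Hardy space `ℍ^p`, `0 < p < ∞`. -/
def MemHardy (p : ℝ) (F : ℂ → ℂ) : Prop :=
  DifferentiableOn ℂ F unitDisc ∧
  ∃ M : ℝ, ∀ r : ℝ, 0 < r → r < 1 → hardyIntegral p F r ≤ M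

/-- `F` belongs to `BMOA` with boundary function `Fb`. -/
def MemBMOA (F : ℂ → ℂ) (Fb : ℝ → ℂ) : Prop :=
  MemHardy 2 F ∧ HasRadialLimits F Fb ∧ IsBMO Fb

/-- `F` belongs to `VMOA` with boundary function `Fb`. -/
def MemVMOA (F : ℂ → ℂ) (Fb : ℝ → ℂ) : Prop :=
  MemHardy 2 F ∧ HasRadialLimits F Fb ∧ IsVMO Fb

/-- The generalized Volterra operator `T_G(F)(z) = ∫₀^z F(w) G'(w) dw`. -/
def volterra (G F : ℂ → ℂ) (z : ℂ) : ℂ :=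
  ∫ t in (0:ℝ)..1, z * F ((t : ℂ) * z) * deriv G ((t : ℂ) * z)


lemma norm_circlePt (θ : ℝ) : ‖circlePt θ‖ = 1 := Complex.norm_exp_ofReal_mul_I θ

lemma continuous_circlePt : Continuous circlePt := by
  unfold circlePt; fun_prop

lemma circlePt_periodic : Function.Periodic circlePt (2 * Real.pi) := fun θ => by
  unfold circlePt
  push_cast
  rw [add_mul, Complex.exp_add, Complex.exp_two_pi_mul_I, mul_one]

/-- The reproducing kernel obtained from the Cauchy kernel at `z` by multiplying with the cube
of `(1 - |z|²) / (1 - \bar z ζ)`, which takes the value `1` at `z`. -/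
def cubicKernel (z : ℂ) (θ : ℝ) : ℂ :=
  ((1 - ‖z‖ ^ 2 : ℝ) / (1 - (starRingEnd ℂ) z * circlePt θ)) ^ 3 *
    (circlePt θ / (circlePt θ - z))

lemma one_sub_conj_mul_ne_zero {z w : ℂ} (hz : ‖z‖ < 1) (hw : ‖w‖ ≤ 1) :
    1 - (starRingEnd ℂ) z * w ≠ 0 := by
  intro h
  have h1 : ‖(starRingEnd ℂ) z * w‖ = 1 := by rw [← sub_eq_zero.1 h, norm_one]
  rw [norm_mul, RCLike.norm_conj] at h1
  nlinarith [norm_nonneg z, norm_nonneg w]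

lemma circlePt_sub_ne_zero {z : ℂ} (hz : ‖z‖ < 1) (θ : ℝ) : circlePt θ - z ≠ 0 := by
  intro h
  rw [← sub_eq_zero.1 h, norm_circlePt] at hz
  exact lt_irrefl _ hz

lemma continuous_cubicKernel {z : ℂ} (hz : ‖z‖ < 1) : Continuous (cubicKernel z) := by
  unfold cubicKernel
  have := continuous_circlePt
  refine Continuous.mul (Continuous.pow (Continuous.div₀ (by fun_prop) (by fun_prop) ?_) 3)
    (Continuous.div₀ (by fun_prop) (by fun_prop) fun θ => circlePt_sub_ne_zero hz θ)
  exact fun θ => one_sub_conj_mul_ne_zero hz (norm_circlePt θ).le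

lemma norm_one_sub_conj_mul_circlePt (z : ℂ) (θ : ℝ) :
    ‖1 - (starRingEnd ℂ) z * circlePt θ‖ = ‖circlePt θ - z‖ := by
  have h : (starRingEnd ℂ) (circlePt θ) * circlePt θ = 1 := by
    rw [mul_comm, Complex.mul_conj, Complex.normSq_eq_norm_sq, norm_circlePt]; simp
  have : 1 - (starRingEnd ℂ) z * circlePt θ =
      (starRingEnd ℂ) (circlePt θ - z) * circlePt θ := by
    rw [map_sub, sub_mul, h]
  rw [this, norm_mul, RCLike.norm_conj, norm_circlePt, mul_one]

lemma norm_cubicKernel {z : ℂ} (hz : ‖z‖ < 1) (θ : ℝ) :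
    ‖cubicKernel z θ‖ = (1 - ‖z‖ ^ 2) ^ 3 / ‖circlePt θ - z‖ ^ 4 := by
  have h1 : 0 ≤ 1 - ‖z‖ ^ 2 := by nlinarith [norm_nonneg z]
  rw [cubicKernel, norm_mul, norm_pow, norm_div, norm_div, norm_one_sub_conj_mul_circlePt,
    norm_circlePt, Complex.norm_real, Real.norm_of_nonneg h1]
  have := norm_ne_zero_iff.2 (circlePt_sub_ne_zero hz θ)
  field_simp

lemma integral_cubicKernel_mul {F : ℂ → ℂ} (hF : DifferentiableOn ℂ F unitDisc) {r : ℝ}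
    (hr0 : 0 ≤ r) (hr : r < 1) {z : ℂ} (hz : ‖z‖ < 1) (c : ℂ) :
    ∫ θ in (0 : ℝ)..2 * Real.pi, cubicKernel z θ * (F (r * circlePt θ) - c) =
      2 * Real.pi * (F (r * z) - c) := by
  have hopen : IsOpen unitDisc := isOpen_lt continuous_norm continuous_const
  set f : ℂ → ℂ := fun w =>
    ((1 - ‖z‖ ^ 2 : ℝ) / (1 - (starRingEnd ℂ) z * w)) ^ 3 * (F (r * w) - c) with hf
  have hd : ∀ w ∈ Metric.closedBall (0 : ℂ) 1, DifferentiableAt ℂ f w := by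
    intro w hw
    rw [mem_closedBall_zero_iff] at hw
    have hrw : (r : ℂ) * w ∈ unitDisc := by
      simp only [unitDisc, mem_ofPred_eq, norm_mul, Complex.norm_real, Real.norm_of_nonneg hr0]
      nlinarith [norm_nonneg w]
    have h1 : DifferentiableAt ℂ (fun w : ℂ => F (r * w)) w :=
      DifferentiableAt.comp (g := F) (f := fun w : ℂ => (r : ℂ) * w) w
        (hF.differentiableAt (hopen.mem_nhds hrw)) (by fun_prop)
    have h2 : DifferentiableAt ℂ
        (fun w : ℂ => ((1 - ‖z‖ ^ 2 : ℝ) : ℂ) / (1 - (starRingEnd ℂ) z * w)) w :=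
      DifferentiableAt.fun_div (by fun_prop) (by fun_prop) (one_sub_conj_mul_ne_zero hz hw)
    exact (h2.fun_pow 3).fun_mul (h1.sub_const c)
  have key := Complex.circleIntegral_sub_inv_smul_of_differentiable_on_off_countable
    (R := 1) (c := 0) (w := z) (f := f) countable_empty (by simpa using hz)
    (fun w hw => (hd w hw).continuousAt.continuousWithinAt)
    (fun w hw => hd w (Metric.ball_subset_closedBall hw.1))
  have hfz : f z = F (r * z) - c := by
    have : ((1 - ‖z‖ ^ 2 : ℝ) : ℂ) = 1 - (starRingEnd ℂ) z * z := by
      rw [mul_comm, Complex.mul_conj, Complex.normSq_eq_norm_sq]; push_cast; ring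
    rw [hf]
    simp only
    rw [this, div_self (one_sub_conj_mul_ne_zero hz hz.le), one_pow, one_mul]
  rw [hfz, circleIntegral] at key
  have hI : ∀ θ : ℝ, deriv (circleMap 0 1) θ • (circleMap 0 1 θ - z)⁻¹ • f (circleMap 0 1 θ) =
      Complex.I * (cubicKernel z θ * (F (r * circlePt θ) - c)) := by
    intro θ
    have : circleMap 0 1 θ = circlePt θ := by simp [circleMap, circlePt]
    rw [deriv_circleMap, this, hf, cubicKernel]
    simp only [smul_eq_mul]
    ring
  simp only [hI] at key
  rw [intervalIntegral.integral_const_mul] at key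
  apply mul_left_cancel₀ Complex.I_ne_zero
  rw [key, smul_eq_mul]; ring

lemma unifIntegrable_of_sq_bound {α : Type*} [MeasurableSpace α] {μ : Measure α}
    {ι : Type*} {f : ι → α → ℂ}
    (hf : ∀ i, AEStronglyMeasurable (f i) μ) {M : ℝ}
    (hint : ∀ i, Integrable (fun x => ‖f i x‖ ^ (2 : ℝ)) μ)
    (hM : ∀ i, ∫ x, ‖f i x‖ ^ (2 : ℝ) ∂μ ≤ M) : UnifIntegrable f 1 μ := by
  refine unifIntegrable_of le_rfl ENNReal.one_ne_top hf fun ε hε => ?_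
  have hC : 0 < (|M| + 1) / ε := by positivity
  refine ⟨((|M| + 1) / ε).toNNReal, fun i => ?_⟩
  rw [eLpNorm_one_eq_lintegral_enorm]
  have h2 : ∫⁻ x, ENNReal.ofReal (ε / (|M| + 1) * ‖f i x‖ ^ (2 : ℝ)) ∂μ ≤ ENNReal.ofReal ε := by
    rw [← ofReal_integral_eq_lintegral_ofReal ((hint i).const_mul _)
      (Eventually.of_forall fun x => by positivity), integral_const_mul]
    apply ENNReal.ofReal_le_ofReal
    rw [div_mul_eq_mul_div, div_le_iff₀ (by positivity)]
    have := (hM i).trans (le_abs_self M)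
    nlinarith
  refine (lintegral_mono fun x => ?_).trans h2
  by_cases hx : x ∈ {x | ((|M| + 1) / ε).toNNReal ≤ ‖f i x‖₊}
  · rw [indicator_of_mem hx, ← ofReal_norm]
    apply ENNReal.ofReal_le_ofReal
    have hx' : (|M| + 1) / ε ≤ ‖f i x‖ := (Real.toNNReal_le_iff_le_coe).1 hx
    rw [Real.rpow_two, div_mul_eq_mul_div, le_div_iff₀ (by positivity)]
    rw [div_le_iff₀ hε] at hx'
    nlinarith [norm_nonneg (f i x)]
  · rw [indicator_of_notMem hx]; simp

lemma integral_cubicKernel_mul_boundary {F : ℂ → ℂ} {Fb : ℝ → ℂ} (hF : MemHardy 2 F)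
    (hlim : HasRadialLimits F Fb) (hint : IntegrableOn Fb (Ioc 0 (2 * Real.pi)))
    {z : ℂ} (hz : ‖z‖ < 1) (c : ℂ) :
    ∫ θ in Ioc 0 (2 * Real.pi), cubicKernel z θ * (Fb θ - c) =
      2 * Real.pi * (F z - c) := by
  have hopen : IsOpen unitDisc := isOpen_lt continuous_norm continuous_const
  obtain ⟨hd, M, hM⟩ := hF
  set r : ℕ → ℝ := fun n => 1 - 1 / ((n : ℝ) + 2) with hr
  have hr0 : ∀ n, 0 < r n := fun n => by
    have : 1 / ((n : ℝ) + 2) < 1 := by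
      rw [div_lt_one (by positivity)]; linarith [(Nat.cast_nonneg n : (0 : ℝ) ≤ n)]
    simp only [hr]; linarith
  have hr1 : ∀ n, r n < 1 := fun n => by
    have : 0 < 1 / ((n : ℝ) + 2) := by positivity
    simp only [hr]; linarith
  have hrt : Tendsto r atTop (𝓝[<] 1) := by
    refine tendsto_nhdsWithin_iff.2 ⟨?_, Eventually.of_forall hr1⟩
    have : Tendsto (fun n : ℕ => 1 / ((n : ℝ) + 2)) atTop (𝓝 0) := by
      have := (tendsto_one_div_add_atTop_nhds_zero_nat (𝕜 := ℝ)).comp (tendsto_add_atTop_nat 1)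
      refine this.congr fun n => ?_
      simp only [Function.comp]; push_cast; ring
    simpa [hr] using this.const_sub 1
  set μ := volume.restrict (Ioc (0 : ℝ) (2 * Real.pi)) with hμ
  set G : ℕ → ℝ → ℂ := fun n θ => F (r n * circlePt θ) with hG
  have hGc : ∀ n, Continuous (G n) := fun n => by
    refine hd.continuousOn.comp_continuous (by have := continuous_circlePt; fun_prop) fun θ => ?_
    simp only [unitDisc, mem_ofPred_eq, norm_mul, Complex.norm_real, norm_circlePt,
      Real.norm_of_nonneg (hr0 n).le, mul_one, hr1 n]
  have hii : ∀ {g : ℝ → ℝ}, Continuous g → Integrable g μ := fun hg =>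
    (hg.integrableOn_Icc).mono_set Ioc_subset_Icc_self
  have hii' : ∀ {g : ℝ → ℂ}, Continuous g → Integrable g μ := fun hg =>
    (hg.integrableOn_Icc).mono_set Ioc_subset_Icc_self
  have hui : UnifIntegrable G 1 μ :=
    unifIntegrable_of_sq_bound (fun n => (hGc n).aestronglyMeasurable)
      (fun n => hii ((hGc n).norm.rpow_const fun _ => Or.inr (by norm_num)))
      (fun n => hM (r n) (hr0 n) (hr1 n))
  have hae : ∀ᵐ θ ∂μ, Tendsto (fun n => G n θ) atTop (𝓝 (Fb θ)) := by
    filter_upwards [hlim] with θ hθ using hθ.comp hrt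
  have hL1 := tendsto_Lp_finite_of_tendsto_ae le_rfl ENNReal.one_ne_top
    (fun n => (hGc n).aestronglyMeasurable) (memLp_one_iff_integrable.2 hint) hui hae
  obtain ⟨B, hB⟩ : ∃ B : ℝ, ∀ θ ∈ Icc 0 (2 * Real.pi), ‖cubicKernel z θ‖ ≤ B :=
    isCompact_Icc.exists_bound_of_continuousOn (continuous_cubicKernel hz).continuousOn
  have hKm : ∀ {g : ℝ → ℂ}, Integrable g μ → Integrable (fun θ => cubicKernel z θ * g θ) μ := by
    intro g hg
    refine hg.bdd_mul (c := B) (continuous_cubicKernel hz).aestronglyMeasurable ?_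
    exact (ae_restrict_iff' measurableSet_Ioc).2
      (Eventually.of_forall fun θ hθ => hB θ (Ioc_subset_Icc_self hθ))
  have hconst : Integrable (fun _ : ℝ => c) μ := hii' continuous_const
  have hlimI : Tendsto (fun n => ∫ θ, cubicKernel z θ * (G n θ - c) ∂μ) atTop
      (𝓝 (∫ θ, cubicKernel z θ * (Fb θ - c) ∂μ)) := by
    refine tendsto_integral_of_L1 _
      (hKm (g := fun θ => Fb θ - c) (hint.sub hconst)).aestronglyMeasurable
      (Eventually.of_forall fun n => hKm ((hii' (hGc n)).sub hconst)) ?_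
    have h0 : Tendsto (fun n => ENNReal.ofReal B * eLpNorm (G n - Fb) 1 μ) atTop (𝓝 0) := by
      simpa using ENNReal.Tendsto.const_mul hL1 (Or.inr ENNReal.ofReal_ne_top)
    refine tendsto_of_tendsto_of_tendsto_of_le_of_le tendsto_const_nhds h0
      (fun _ => zero_le) fun n => ?_
    rw [eLpNorm_one_eq_lintegral_enorm, ← lintegral_const_mul' _ _ ENNReal.ofReal_ne_top]
    refine lintegral_mono_ae ((ae_restrict_iff' measurableSet_Ioc).2
      (Eventually.of_forall fun θ hθ => ?_))
    rw [← mul_sub, sub_sub_sub_cancel_right, enorm_mul, Pi.sub_apply]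
    gcongr
    rw [← ofReal_norm]
    exact ENNReal.ofReal_le_ofReal (hB θ (Ioc_subset_Icc_self hθ))
  have hlimF : Tendsto (fun n => 2 * Real.pi * (F (r n * z) - c)) atTop
      (𝓝 (2 * Real.pi * (F z - c))) := by
    have h1 : Tendsto (fun n => (r n : ℂ) * z) atTop (𝓝 z) := by
      have := ((Complex.continuous_ofReal.tendsto 1).comp
        (tendsto_nhdsWithin_iff.1 hrt).1).mul_const z
      simpa using this
    have h2 : ContinuousAt F z := hd.continuousOn.continuousAt (hopen.mem_nhds hz)
    exact ((h2.tendsto.comp h1).sub_const c).const_mul _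
  refine tendsto_nhds_unique hlimI (hlimF.congr fun n => ?_)
  rw [← integral_cubicKernel_mul hd (hr0 n).le (hr1 n) hz c,
    intervalIntegral.integral_of_le (by positivity)]

lemma integrableOn_arc {f : ℝ → ℂ} (hper : ∀ θ, f (θ + 2 * Real.pi) = f θ)
    (hint : IntegrableOn f (Ioc 0 (2 * Real.pi))) (a b : ℝ) : IntegrableOn f (Ioo a b) := by
  have hp : Function.Periodic f (2 * Real.pi) := hper
  have h0 : IntervalIntegrable f volume 0 (0 + 2 * Real.pi) := by
    rw [zero_add, intervalIntegrable_iff_integrableOn_Ioc_of_le (by positivity)]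
    exact hint
  have h1 := hp.intervalIntegrable Real.two_pi_pos.ne' h0 a b
  rcases le_or_gt a b with hab | hab
  · exact ((intervalIntegrable_iff_integrableOn_Ioc_of_le hab).1 h1).mono_set Ioo_subset_Ioc_self
  · rw [Ioo_eq_empty hab.le.not_gt]; exact integrableOn_empty

section Oscillation

variable {f : ℝ → ℂ}

lemma integrableOn_norm_sub_const (hf : ∀ a b, IntegrableOn f (Ioo a b)) (c : ℂ) (a b : ℝ) :
    IntegrableOn (fun θ => ‖f θ - c‖) (Ioo a b) :=
  ((hf a b).sub (integrableOn_const (by simp))).norm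

lemma volume_real_arc (θ₀ : ℝ) {s : ℝ} (hs : 0 < s) :
    volume.real (Ioo (θ₀ - Real.pi * s) (θ₀ + Real.pi * s)) = 2 * Real.pi * s := by
  have := Real.pi_pos
  rw [Real.volume_real_Ioo_of_le (by nlinarith)]; ring

lemma integral_arc_norm_sub_arcAvg (θ₀ : ℝ) {s : ℝ} (hs : 0 < s) :
    ∫ θ in Ioo (θ₀ - Real.pi * s) (θ₀ + Real.pi * s), ‖f θ - arcAvg f θ₀ s‖ =
      2 * Real.pi * s * meanOsc f θ₀ s := by
  have := Real.pi_pos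
  rw [meanOsc, mul_inv_cancel_left₀ (by positivity)]

lemma meanOsc_nonneg (θ₀ : ℝ) {s : ℝ} (hs : 0 < s) : 0 ≤ meanOsc f θ₀ s := by
  have := Real.pi_pos
  unfold meanOsc; positivity

lemma norm_arcAvg_sub_le (hf : ∀ a b, IntegrableOn f (Ioo a b)) (c : ℂ) (θ₀ : ℝ) {s : ℝ}
    (hs : 0 < s) :
    2 * Real.pi * s * ‖arcAvg f θ₀ s - c‖ ≤
      ∫ θ in Ioo (θ₀ - Real.pi * s) (θ₀ + Real.pi * s), ‖f θ - c‖ := by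
  have hpi := Real.pi_pos
  refine le_trans (le_of_eq ?_) (norm_integral_le_integral_norm _)
  rw [integral_sub (hf _ _) (integrableOn_const (by simp)), setIntegral_const,
    volume_real_arc θ₀ hs]
  have : ∫ θ in Ioo (θ₀ - Real.pi * s) (θ₀ + Real.pi * s), f θ =
      (2 * Real.pi * s) • arcAvg f θ₀ s := by
    rw [arcAvg, smul_inv_smul₀ (by positivity)]
  rw [this, ← smul_sub, norm_smul, Real.norm_of_nonneg (by positivity)]

lemma norm_arcAvg_sub_arcAvg_le (hf : ∀ a b, IntegrableOn f (Ioo a b)) (θ₀ : ℝ) {h s : ℝ}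
    (hh : 0 < h) (hs : h ≤ s) :
    h * ‖arcAvg f θ₀ h - arcAvg f θ₀ s‖ ≤ s * meanOsc f θ₀ s := by
  have hpi := Real.pi_pos
  have h1 := norm_arcAvg_sub_le hf (arcAvg f θ₀ s) θ₀ hh
  have h2 : ∫ θ in Ioo (θ₀ - Real.pi * h) (θ₀ + Real.pi * h), ‖f θ - arcAvg f θ₀ s‖ ≤
      ∫ θ in Ioo (θ₀ - Real.pi * s) (θ₀ + Real.pi * s), ‖f θ - arcAvg f θ₀ s‖ :=
    setIntegral_mono_set (integrableOn_norm_sub_const hf _ _ _)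
      (Eventually.of_forall fun _ => norm_nonneg _)
      (Ioo_subset_Ioo (by nlinarith) (by nlinarith)).eventuallyLE
  rw [integral_arc_norm_sub_arcAvg θ₀ (hh.trans_le hs)] at h2
  refine le_of_mul_le_mul_left ?_ (show 0 < 2 * Real.pi by positivity)
  linarith

lemma integral_arc_norm_sub_arcAvg_le (hf : ∀ a b, IntegrableOn f (Ioo a b)) (θ₀ : ℝ) {h s : ℝ}
    (hh : 0 < h) (hs : h ≤ s) :
    ∫ θ in Ioo (θ₀ - Real.pi * s) (θ₀ + Real.pi * s), ‖f θ - arcAvg f θ₀ h‖ ≤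
      2 * Real.pi * s * (1 + s / h) * meanOsc f θ₀ s := by
  have hpi := Real.pi_pos
  have hs0 := hh.trans_le hs
  have h1 : ∫ θ in Ioo (θ₀ - Real.pi * s) (θ₀ + Real.pi * s), ‖f θ - arcAvg f θ₀ h‖ ≤
      ∫ θ in Ioo (θ₀ - Real.pi * s) (θ₀ + Real.pi * s),
        (‖f θ - arcAvg f θ₀ s‖ + ‖arcAvg f θ₀ h - arcAvg f θ₀ s‖) := by
    refine integral_mono (integrableOn_norm_sub_const hf _ _ _)
      ((integrableOn_norm_sub_const hf _ _ _).add (integrableOn_const (by simp))) fun θ => ?_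
    simpa [norm_sub_rev (arcAvg f θ₀ s)] using
      norm_sub_le_norm_sub_add_norm_sub (f θ) (arcAvg f θ₀ s) (arcAvg f θ₀ h)
  rw [integral_add (integrableOn_norm_sub_const hf _ _ _) (integrableOn_const (by simp)),
    setIntegral_const, volume_real_arc θ₀ hs0, integral_arc_norm_sub_arcAvg θ₀ hs0,
    smul_eq_mul] at h1
  have h2 : ‖arcAvg f θ₀ h - arcAvg f θ₀ s‖ ≤ s / h * meanOsc f θ₀ s := by
    rw [div_mul_eq_mul_div, le_div_iff₀ hh, mul_comm]
    exact norm_arcAvg_sub_arcAvg_le hf θ₀ hh hs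
  have h3 := mul_le_mul_of_nonneg_left h2 (show 0 ≤ 2 * Real.pi * s by positivity)
  linarith

end Oscillation

lemma abs_sub_div_pi_le_norm_circlePt_sub {h θ θ₀ : ℝ} (hh : 0 ≤ h) (hh1 : h ≤ 1)
    (hθ : |θ - θ₀| ≤ Real.pi) :
    |θ - θ₀| / Real.pi ≤ ‖circlePt θ - ((1 - h : ℝ) : ℂ) * circlePt θ₀‖ := by
  have hpi := Real.pi_pos
  have h1 : h ≤ ‖circlePt θ - ((1 - h : ℝ) : ℂ) * circlePt θ₀‖ := by
    have := norm_sub_norm_le (circlePt θ) (((1 - h : ℝ) : ℂ) * circlePt θ₀)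
    rw [norm_mul, Complex.norm_real, norm_circlePt, norm_circlePt,
      Real.norm_of_nonneg (by linarith)] at this
    linarith
  have h2 : ‖circlePt θ - circlePt θ₀‖ ≤
      ‖circlePt θ - ((1 - h : ℝ) : ℂ) * circlePt θ₀‖ + h := by
    have := norm_sub_le_norm_sub_add_norm_sub (circlePt θ) (((1 - h : ℝ) : ℂ) * circlePt θ₀)
      (circlePt θ₀)
    have h3 : ‖((1 - h : ℝ) : ℂ) * circlePt θ₀ - circlePt θ₀‖ = h := by
      have : ((1 - h : ℝ) : ℂ) * circlePt θ₀ - circlePt θ₀ = ((-h : ℝ) : ℂ) * circlePt θ₀ := by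
        push_cast; ring
      rw [this, norm_mul, norm_circlePt, Complex.norm_real, norm_neg, Real.norm_of_nonneg hh,
        mul_one]
    linarith
  have h3 : ‖circlePt θ - circlePt θ₀‖ = 2 * |Real.sin ((θ - θ₀) / 2)| := by
    have : circlePt θ - circlePt θ₀ =
        circlePt θ₀ * (Complex.exp (Complex.I * ((θ - θ₀ : ℝ) : ℂ)) - 1) := by
      unfold circlePt
      rw [mul_sub, ← Complex.exp_add, mul_one]
      congr 2; push_cast; ring
    rw [this, norm_mul, norm_circlePt, one_mul, Complex.norm_exp_I_mul_ofReal_sub_one,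
      norm_mul, Real.norm_eq_abs, Real.norm_eq_abs, abs_two]
  have h4 := Real.mul_abs_le_abs_sin (x := (θ - θ₀) / 2) (by
    rw [abs_div, abs_two]; linarith)
  rw [abs_div, abs_two] at h4
  have h5 : 2 / Real.pi * (|θ - θ₀| / 2) = |θ - θ₀| / Real.pi := by ring
  linarith

lemma norm_cubicKernel_le {h : ℝ} (hh : 0 < h) (hh1 : h ≤ 1) (θ₀ θ : ℝ) :
    ‖cubicKernel (((1 - h : ℝ) : ℂ) * circlePt θ₀) θ‖ ≤
      8 * h ^ 3 / ‖circlePt θ - ((1 - h : ℝ) : ℂ) * circlePt θ₀‖ ^ 4 := by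
  have hn : ‖((1 - h : ℝ) : ℂ) * circlePt θ₀‖ = 1 - h := by
    rw [norm_mul, Complex.norm_real, norm_circlePt, Real.norm_of_nonneg (by linarith), mul_one]
  rw [norm_cubicKernel (by rw [hn]; linarith), hn]
  have h0 : 0 ≤ 1 - (1 - h) ^ 2 := by nlinarith
  have h1 : (1 - (1 - h) ^ 2) ^ 3 ≤ (2 * h) ^ 3 := pow_le_pow_left₀ h0 (by nlinarith) 3
  gcongr
  linarith [show (2 * h) ^ 3 = 8 * h ^ 3 by ring]

/-- Domination of the cubic kernel by indicators of dyadic arcs. -/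
lemma norm_cubicKernel_le_sum {h : ℝ} (hh : 0 < h) (hh1 : h ≤ 1) {M : ℕ} (hM : 1 ≤ 2 ^ M * h)
    {θ₀ θ : ℝ} (hθ : |θ - θ₀| < Real.pi) :
    ‖cubicKernel (((1 - h : ℝ) : ℂ) * circlePt θ₀) θ‖ ≤
      ∑ j ∈ Finset.range (M + 1), (Ioo (θ₀ - Real.pi * min (2 ^ j * h) 1)
        (θ₀ + Real.pi * min (2 ^ j * h) 1)).indicator (fun _ => 128 / (h * 16 ^ j)) θ := by
  classical
  have hpi := Real.pi_pos
  set D := ‖circlePt θ - ((1 - h : ℝ) : ℂ) * circlePt θ₀‖ with hD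
  have hDh : h ≤ D := by
    have := norm_sub_norm_le (circlePt θ) (((1 - h : ℝ) : ℂ) * circlePt θ₀)
    rw [norm_mul, Complex.norm_real, norm_circlePt, norm_circlePt,
      Real.norm_of_nonneg (by linarith)] at this
    linarith
  have hDx := abs_sub_div_pi_le_norm_circlePt_sub hh.le hh1 hθ.le
  have hex : ∃ j : ℕ, |θ - θ₀| < Real.pi * min (2 ^ j * h) 1 :=
    ⟨M, by rw [min_eq_right hM, mul_one]; exact hθ⟩
  set j := Nat.find hex with hj
  have hjs : |θ - θ₀| < Real.pi * min (2 ^ j * h) 1 := Nat.find_spec hex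
  have hjM : j ∈ Finset.range (M + 1) := by
    rw [Finset.mem_range, Nat.lt_succ_iff]
    exact Nat.find_min' hex (by rw [min_eq_right hM, mul_one]; exact hθ)
  have hterm : ‖cubicKernel (((1 - h : ℝ) : ℂ) * circlePt θ₀) θ‖ ≤ 128 / (h * 16 ^ j) := by
    refine (norm_cubicKernel_le hh hh1 θ₀ θ).trans ?_
    have hlow : 2 ^ j * h / 2 ≤ D := by
      rcases Nat.eq_zero_or_pos j with h0 | h0
      · rw [h0]; linarith
      · have hlt : ¬ |θ - θ₀| < Real.pi * min (2 ^ (j - 1) * h) 1 :=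
          Nat.find_min hex (Nat.sub_lt h0 one_pos)
        have hlt2 : 2 ^ (j - 1) * h < 1 := by
          by_contra! hc
          rw [min_eq_right hc, mul_one] at hlt
          exact hlt hθ
        rw [min_eq_left hlt2.le, not_lt] at hlt
        have h2 : (2 : ℝ) ^ j = 2 ^ (j - 1) * 2 := by
          rw [← pow_succ, Nat.sub_add_cancel h0]
        refine le_trans ?_ hDx
        rw [le_div_iff₀ hpi, h2]
        linarith
    have hl4 : (2 ^ j * h / 2) ^ 4 ≤ D ^ 4 := pow_le_pow_left₀ (by positivity) hlow 4
    refine (div_le_div_of_nonneg_left (by positivity) (by positivity) hl4).trans (le_of_eq ?_)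
    have h16 : (16 : ℝ) ^ j = (2 ^ j) ^ 4 := by rw [← pow_mul, mul_comm, pow_mul]; norm_num
    rw [h16]
    field_simp
    norm_num
  refine hterm.trans ?_
  have hmem : θ ∈ Ioo (θ₀ - Real.pi * min (2 ^ j * h) 1) (θ₀ + Real.pi * min (2 ^ j * h) 1) := by
    rw [abs_lt] at hjs
    exact ⟨by linarith [hjs.1], by linarith [hjs.2]⟩
  refine le_trans (le_of_eq (indicator_of_mem hmem (fun _ => 128 / (h * 16 ^ j))).symm)
    (Finset.single_le_sum (f := fun j => (Ioo (θ₀ - Real.pi * min (2 ^ j * h) 1)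
      (θ₀ + Real.pi * min (2 ^ j * h) 1)).indicator (fun _ => 128 / (h * 16 ^ j)) θ)
      (fun i _ => indicator_nonneg (fun _ _ => by positivity) _) hjM)

lemma norm_sub_const_le_integral {F : ℂ → ℂ} {Fb : ℝ → ℂ} (hF : MemHardy 2 F)
    (hlim : HasRadialLimits F Fb) (hper : ∀ θ, Fb (θ + 2 * Real.pi) = Fb θ)
    (hint : IntegrableOn Fb (Ioc 0 (2 * Real.pi)))
    {z : ℂ} (hz : ‖z‖ < 1) (c : ℂ) (θ₀ : ℝ) :
    2 * Real.pi * ‖F z - c‖ ≤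
      ∫ θ in Ioo (θ₀ - Real.pi) (θ₀ + Real.pi), ‖cubicKernel z θ‖ * ‖Fb θ - c‖ := by
  have hpi := Real.pi_pos
  have hp : Function.Periodic (fun θ => cubicKernel z θ * (Fb θ - c)) (2 * Real.pi) := fun θ => by
    simp only [cubicKernel, circlePt_periodic θ, hper θ]
  have h1 := integral_cubicKernel_mul_boundary hF hlim hint hz c
  rw [← intervalIntegral.integral_of_le (by positivity)] at h1
  have h2 := hp.intervalIntegral_add_eq 0 (θ₀ - Real.pi)
  rw [zero_add, h1, show θ₀ - Real.pi + 2 * Real.pi = θ₀ + Real.pi by ring,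
    intervalIntegral.integral_of_le (by linarith), integral_Ioc_eq_integral_Ioo] at h2
  have h3 : ‖(2 : ℂ) * Real.pi * (F z - c)‖ = 2 * Real.pi * ‖F z - c‖ := by
    rw [norm_mul, norm_mul, Complex.norm_real, Real.norm_of_nonneg hpi.le]; simp
  rw [← h3, h2]
  refine (norm_integral_le_integral_norm _).trans (le_of_eq ?_)
  simp only [norm_mul]

/-- Pointwise comparison of a Hardy function with the average of its boundary values over the
corresponding arc, under an affine bound for the mean oscillations. -/
lemma norm_sub_arcAvg_le {F : ℂ → ℂ} {Fb : ℝ → ℂ} (hF : MemHardy 2 F)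
    (hlim : HasRadialLimits F Fb) (hper : ∀ θ, Fb (θ + 2 * Real.pi) = Fb θ)
    (hint : IntegrableOn Fb (Ioc 0 (2 * Real.pi))) {θ₀ a b : ℝ} (ha : 0 ≤ a) (hb : 0 ≤ b)
    (hosc : ∀ s, 0 < s → s ≤ 1 → meanOsc Fb θ₀ s ≤ a + b * s)
    {h : ℝ} (hh : 0 < h) (hh1 : h ≤ 1) :
    ‖F (((1 - h : ℝ) : ℂ) * circlePt θ₀) - arcAvg Fb θ₀ h‖ ≤ 512 * (a + b * h) := by
  have hpi := Real.pi_pos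
  have hf := integrableOn_arc hper hint
  set c := arcAvg Fb θ₀ h with hc
  obtain ⟨M, hM⟩ : ∃ M : ℕ, 1 ≤ 2 ^ M * h := by
    obtain ⟨M, hM⟩ := pow_unbounded_of_one_lt (1 / h) (one_lt_two)
    exact ⟨M, by rw [div_lt_iff₀ hh] at hM; exact hM.le⟩
  have hz : ‖((1 - h : ℝ) : ℂ) * circlePt θ₀‖ < 1 := by
    rw [norm_mul, Complex.norm_real, norm_circlePt, Real.norm_of_nonneg (by linarith)]
    linarith
  set A : ℕ → Set ℝ := fun j =>
    Ioo (θ₀ - Real.pi * min (2 ^ j * h) 1) (θ₀ + Real.pi * min (2 ^ j * h) 1) with hA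
  have hAsub : ∀ j, A j ⊆ Ioo (θ₀ - Real.pi) (θ₀ + Real.pi) := fun j => by
    have : min (2 ^ j * h) 1 ≤ 1 := min_le_right _ _
    exact Ioo_subset_Ioo (by nlinarith) (by nlinarith)
  have hg := integrableOn_norm_sub_const hf c
  have hterm : ∀ j, IntegrableOn
      (fun θ => (A j).indicator (fun θ => 128 / (h * 16 ^ j) * ‖Fb θ - c‖) θ)
      (Ioo (θ₀ - Real.pi) (θ₀ + Real.pi)) := fun j =>
    ((hg _ _).const_mul _).indicator measurableSet_Ioo
  have h1 : 2 * Real.pi * ‖F (((1 - h : ℝ) : ℂ) * circlePt θ₀) - c‖ ≤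
      ∑ j ∈ Finset.range (M + 1), 128 / (h * 16 ^ j) * ∫ θ in A j, ‖Fb θ - c‖ := by
    refine (norm_sub_const_le_integral hF hlim hper hint hz c θ₀).trans ?_
    have h2 : ∫ θ in Ioo (θ₀ - Real.pi) (θ₀ + Real.pi),
        ‖cubicKernel (((1 - h : ℝ) : ℂ) * circlePt θ₀) θ‖ * ‖Fb θ - c‖ ≤
        ∫ θ in Ioo (θ₀ - Real.pi) (θ₀ + Real.pi), ∑ j ∈ Finset.range (M + 1),
          (A j).indicator (fun θ => 128 / (h * 16 ^ j) * ‖Fb θ - c‖) θ := by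
      refine integral_mono_of_nonneg (Eventually.of_forall fun θ => by positivity)
        (integrable_finsetSum _ fun j _ => hterm j)
        ((ae_restrict_iff' measurableSet_Ioo).2 (Eventually.of_forall fun θ hθ => ?_))
      have hθ' : |θ - θ₀| < Real.pi := by
        rw [abs_lt]; exact ⟨by linarith [hθ.1], by linarith [hθ.2]⟩
      refine (mul_le_mul_of_nonneg_right (norm_cubicKernel_le_sum hh hh1 hM hθ')
        (norm_nonneg _)).trans (le_of_eq ?_)
      rw [Finset.sum_mul]
      refine Finset.sum_congr rfl fun j _ => ?_
      by_cases hj : θ ∈ A j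
      · rw [indicator_of_mem hj, indicator_of_mem hj]
      · rw [indicator_of_notMem hj, indicator_of_notMem hj, zero_mul]
    refine h2.trans (le_of_eq ?_)
    rw [integral_finsetSum _ fun j _ => hterm j]
    refine Finset.sum_congr rfl fun j _ => ?_
    rw [setIntegral_indicator measurableSet_Ioo, inter_eq_right.2 (hAsub j), integral_const_mul]
  have h2 : ∀ j : ℕ, 128 / (h * 16 ^ j) * ∫ θ in A j, ‖Fb θ - c‖ ≤
      2 * Real.pi * (256 * (a + b * h)) * (1 / 2) ^ j := by
    intro j
    set s := min (2 ^ j * h) 1 with hs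
    have hp1 : (1 : ℝ) ≤ 2 ^ j := one_le_pow₀ one_le_two
    have hhs : h ≤ s := le_min (by nlinarith) hh1
    have hs0 : 0 < s := hh.trans_le hhs
    have hs2 : s ≤ 2 ^ j * h := min_le_left _ _
    have h3 : s / h ≤ 2 ^ j := by rwa [div_le_iff₀ hh]
    have h4 : meanOsc Fb θ₀ s ≤ 2 ^ j * (a + b * h) := by
      refine (hosc s hs0 (min_le_right _ _)).trans ?_
      have := mul_le_mul_of_nonneg_left hs2 hb
      nlinarith
    have h5 : ∫ θ in A j, ‖Fb θ - c‖ ≤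
        2 * Real.pi * (2 ^ j * h) * (2 * 2 ^ j) * (2 ^ j * (a + b * h)) := by
      refine (integral_arc_norm_sub_arcAvg_le hf θ₀ hh hhs).trans ?_
      have := meanOsc_nonneg (f := Fb) θ₀ hs0
      gcongr
      linarith
    refine (mul_le_mul_of_nonneg_left h5 (by positivity)).trans (le_of_eq ?_)
    have h16 : (16 : ℝ) ^ j = (2 ^ j) ^ 4 := by rw [← pow_mul, mul_comm, pow_mul]; norm_num
    rw [h16, one_div, inv_pow]
    field_simp
    ring
  have h3 := h1.trans (Finset.sum_le_sum fun j _ => h2 j)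
  rw [← Finset.mul_sum] at h3
  have h4 : ∑ j ∈ Finset.range (M + 1), (1 / 2 : ℝ) ^ j ≤ 2 := sum_geometric_two_le _
  have h5 := h3.trans (mul_le_mul_of_nonneg_left h4 (by positivity))
  refine le_of_mul_le_mul_left (h5.trans (le_of_eq ?_)) (show 0 < 2 * Real.pi by positivity)
  ring

/-- A weak-type estimate for Carleson measures: if the averages of `f` over the arcs attached to
the points of `S` all differ from `c` by at least `lam`, then `μ S` is controlled by the integral
of `|f - c|` over the doubled arc. -/
lemma measure_le_of_le_norm_arcAvg_sub {μ : Measure ℂ} {C : ℝ} (hC0 : 0 < C)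
    (hC : ∀ θ₀ t : ℝ, 0 < t → t ≤ 1 → μ (carlesonSquare θ₀ t) ≤ ENNReal.ofReal (C * t))
    {f : ℝ → ℂ} (hf : ∀ a b, IntegrableOn f (Ioo a b)) {c : ℂ} {lam : ℝ} (hlam : 0 < lam)
    {θ₀ t : ℝ} (ht : t ≤ 1 / 3) {S : Set ℂ} (hS : S ⊆ carlesonSquare θ₀ t)
    (havg : ∀ z ∈ S, ∀ θ : ℝ, z = (‖z‖ : ℂ) * circlePt θ →
      lam ≤ ‖arcAvg f θ (1 - ‖z‖) - c‖) :
    μ S ≤ ENNReal.ofReal (3 * C / (2 * Real.pi * lam) *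
      ∫ θ in Ioo (θ₀ - Real.pi * (2 * t)) (θ₀ + Real.pi * (2 * t)), ‖f θ - c‖) := by
  have hpi := Real.pi_pos
  have hex : ∀ z : ℂ, ∃ θ : ℝ, z ∈ S → |θ - θ₀| ≤ Real.pi * t ∧ z = (‖z‖ : ℂ) * circlePt θ := by
    intro z
    by_cases hz : z ∈ S
    · obtain ⟨-, -, θ, hθ⟩ := hS hz
      exact ⟨θ, fun _ => hθ⟩
    · exact ⟨0, fun h => absurd h hz⟩
  choose th hth using hex
  have hpos : ∀ z ∈ S, 0 < 1 - ‖z‖ := fun z hz => sub_pos.2 (hS hz).1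
  have hle : ∀ z ∈ S, 1 - ‖z‖ ≤ t := fun z hz => by linarith [(hS hz).2.1]
  set I : ℂ → Set ℝ := fun z =>
    Ioo (th z - Real.pi * (1 - ‖z‖)) (th z + Real.pi * (1 - ‖z‖)) with hI
  have hne : ∀ z ∈ S, (I z).Nonempty := fun z hz =>
    nonempty_Ioo.2 (by nlinarith [mul_pos hpi (hpos z hz)])
  obtain ⟨u, huS, hdisj, hcov⟩ := Vitali.exists_disjoint_subfamily_covering_enlargement I S
    (fun z => 1 - ‖z‖) 2 one_lt_two (fun z hz => (hpos z hz).le) t hle hne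
  have hcount : u.Countable :=
    hdisj.countable_of_isOpen (fun z _ => isOpen_Ioo) fun z hz => hne z (huS hz)
  have hSsub : S ⊆ ⋃ b ∈ u, carlesonSquare (th b) (3 * (1 - ‖b‖)) := by
    intro z hz
    obtain ⟨b, hb, ⟨x, hxz, hxb⟩, hzb⟩ := hcov z hz
    refine mem_biUnion hb ⟨(hS hz).1, ?_, th z, ?_, (hth z hz).2⟩
    · linarith [hpos b (huS hb)]
    · have := mul_le_mul_of_nonneg_left hzb hpi.le
      rw [abs_le]
      constructor <;> nlinarith [hxz.1, hxz.2, hxb.1, hxb.2]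
  set K : ENNReal := ENNReal.ofReal (3 * C / (2 * Real.pi * lam)) with hK
  have hterm : ∀ b ∈ u, μ (carlesonSquare (th b) (3 * (1 - ‖b‖))) ≤
      K * ∫⁻ θ in I b, ENNReal.ofReal ‖f θ - c‖ := by
    intro b hb
    have hb0 := hpos b (huS hb)
    refine (hC _ _ (by linarith) (by linarith [hle b (huS hb)])).trans ?_
    rw [← ofReal_integral_eq_lintegral_ofReal (integrableOn_norm_sub_const hf c _ _)
      (Eventually.of_forall fun _ => norm_nonneg _), hK, ← ENNReal.ofReal_mul (by positivity)]
    apply ENNReal.ofReal_le_ofReal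
    have h1 := norm_arcAvg_sub_le hf c (th b) hb0
    have h2 := havg b (huS hb) (th b) (hth b (huS hb)).2
    rw [div_mul_eq_mul_div, le_div_iff₀ (by positivity)]
    have h3 : 2 * Real.pi * (1 - ‖b‖) * lam ≤ ∫ θ in I b, ‖f θ - c‖ :=
      (mul_le_mul_of_nonneg_left h2 (by positivity)).trans h1
    nlinarith [mul_le_mul_of_nonneg_left h3 hC0.le]
  have hIsub : (⋃ b ∈ u, I b) ⊆
      Ioo (θ₀ - Real.pi * (2 * t)) (θ₀ + Real.pi * (2 * t)) := by
    refine iUnion₂_subset fun b hb => Ioo_subset_Ioo ?_ ?_ <;>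
    · have h1 := abs_le.1 (hth b (huS hb)).1
      have h2 := mul_le_mul_of_nonneg_left (hle b (huS hb)) hpi.le
      linarith [h1.1, h1.2]
  have : Countable u := hcount.to_subtype
  calc μ S ≤ μ (⋃ b ∈ u, carlesonSquare (th b) (3 * (1 - ‖b‖))) := measure_mono hSsub
    _ ≤ ∑' b : u, μ (carlesonSquare (th b) (3 * (1 - ‖(b : ℂ)‖))) :=
      measure_biUnion_le μ hcount _
    _ ≤ ∑' b : u, K * ∫⁻ θ in I b, ENNReal.ofReal ‖f θ - c‖ :=
      ENNReal.tsum_le_tsum fun b => hterm b b.2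
    _ = K * ∫⁻ θ in ⋃ b ∈ u, I b, ENNReal.ofReal ‖f θ - c‖ := by
      rw [ENNReal.tsum_mul_left, lintegral_biUnion hcount (fun _ _ => measurableSet_Ioo) hdisj]
    _ ≤ K * ∫⁻ θ in Ioo (θ₀ - Real.pi * (2 * t)) (θ₀ + Real.pi * (2 * t)),
        ENNReal.ofReal ‖f θ - c‖ := by
      gcongr
    _ = _ := by
      rw [← ofReal_integral_eq_lintegral_ofReal (integrableOn_norm_sub_const hf c _ _)
        (Eventually.of_forall fun _ => norm_nonneg _), hK, ← ENNReal.ofReal_mul (by positivity)]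

lemma aemeasurable_ofReal_norm {μ : Measure ℂ} (hsupp : μ unitDiscᶜ = 0) {E : ℂ → ℂ}
    (hE : DifferentiableOn ℂ E unitDisc) : AEMeasurable (fun z => ENNReal.ofReal ‖E z‖) μ := by
  have hopen : IsOpen unitDisc := isOpen_lt continuous_norm continuous_const
  have h1 : AEMeasurable E (μ.restrict unitDisc) :=
    hE.continuousOn.aemeasurable hopen.measurableSet
  rw [Measure.restrict_eq_self_of_ae_mem (by rwa [ae_iff])] at h1
  exact h1.norm.ennreal_ofReal

lemma IsVMO.exists_affine_bound {f : ℝ → ℂ} (hf : IsVMO f) {a : ℝ} (ha : 0 < a) :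
    ∃ b : ℝ, 0 ≤ b ∧ ∀ θ₀ s, 0 < s → s ≤ 1 → meanOsc f θ₀ s ≤ a + b * s := by
  obtain ⟨⟨-, -, B, hB⟩, hv⟩ := hf
  obtain ⟨δ, hδ, hosc⟩ := hv a ha
  refine ⟨|B| / δ, by positivity, fun θ₀ s hs hs1 => ?_⟩
  rcases lt_or_ge s δ with h | h
  · have : 0 ≤ |B| / δ * s := by positivity
    linarith [hosc θ₀ s hs h]
  · have h1 : |B| ≤ |B| / δ * s := by
      rw [div_mul_eq_mul_div, le_div_iff₀ hδ]
      exact mul_le_mul_of_nonneg_left h (abs_nonneg B)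
    linarith [hB θ₀ s hs hs1, le_abs_self B]

/-- Uniform comparison of a VMOA function near the boundary with the averages of its boundary
values. -/
lemma MemVMOA.exists_norm_sub_arcAvg_le {E : ℂ → ℂ} {Eb : ℝ → ℂ} (hE : MemVMOA E Eb) {η : ℝ}
    (hη : 0 < η) : ∃ δ : ℝ, 0 < δ ∧ ∀ θ₀ h : ℝ, 0 < h → h ≤ 1 → h < δ →
      ‖E (((1 - h : ℝ) : ℂ) * circlePt θ₀) - arcAvg Eb θ₀ h‖ ≤ η := by
  obtain ⟨hH, hlim, hv⟩ := hE
  obtain ⟨b, hb, hosc⟩ := hv.exists_affine_bound (a := η / 1024) (by positivity)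
  refine ⟨η / 1024 / (b + 1), by positivity, fun θ₀ h hh hh1 hδ => ?_⟩
  refine (norm_sub_arcAvg_le hH hlim hv.1.1 hv.1.2.1 (by positivity) hb
    (hosc θ₀) hh hh1).trans ?_
  rw [lt_div_iff₀ (by positivity)] at hδ
  nlinarith

/-- Lemma 2.4: let `μ` be a Carleson measure, `ε > 0`, and `E ∈ VMOA` be such that
`|E|μ` is a vanishing Carleson measure. Then `|E(z_Q)| → 0` as `ℓ(Q) → 0` through the
Carleson squares `Q` with `μ(Q) ≥ ε ℓ(Q)`; here `z_Q = (1 - ℓ(Q)) ξ` with `ξ` the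
center of the arc of `Q`. -/
theorem stmt_8 (μ : Measure ℂ) [IsFiniteMeasure μ] (hsupp : μ unitDiscᶜ = 0)
    (hμ : IsCarleson μ) (ε : ℝ) (hε : 0 < ε)
    (E : ℂ → ℂ) (Eb : ℝ → ℂ) (hE : MemVMOA E Eb)
    (hvan : IsVanishingCarleson (absDensity E μ)) :
    ∀ η : ℝ, 0 < η → ∃ δ : ℝ, 0 < δ ∧ ∀ θ₀ t : ℝ, 0 < t → t ≤ 1 → t < δ →
      ENNReal.ofReal (ε * t) ≤ μ (carlesonSquare θ₀ t) →
      ‖E (((1 - t : ℝ) : ℂ) * circlePt θ₀)‖ ≤ η := by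
  intro η hη
  have hpi := Real.pi_pos
  obtain ⟨C, hC0, hC⟩ := hμ
  obtain ⟨δ₁, hδ₁, hpt⟩ := hE.exists_norm_sub_arcAvg_le (η := η / 16) (by positivity)
  obtain ⟨hH, hlim, hv⟩ := hE
  have hf := integrableOn_arc hv.1.1 hv.1.2.1
  set κ := min (η / 16) (ε * (η / 4) / (24 * C)) with hκ
  have hκ0 : 0 < κ := by positivity
  obtain ⟨δ₂, hδ₂, hosc⟩ := hv.2 κ hκ0
  obtain ⟨δ₃, hδ₃, hvQ⟩ := hvan.2 (ε * η / 8) (by positivity)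
  refine ⟨min (min δ₁ (δ₂ / 2)) (min δ₃ (1 / 3)), by positivity, fun θ₀ t ht ht1 htδ hQ => ?_⟩
  simp only [lt_min_iff] at htδ
  obtain ⟨⟨ht₁, ht₂⟩, ht₃, ht₄⟩ := htδ
  by_contra! hbig
  set Q := carlesonSquare θ₀ t with hQdef
  set c := arcAvg Eb θ₀ (2 * t) with hc
  have hosc2 : meanOsc Eb θ₀ (2 * t) ≤ κ := hosc θ₀ (2 * t) (by linarith) (by linarith)
  have hc_big : 13 * η / 16 ≤ ‖c‖ := by
    have h1 := hpt θ₀ t ht ht1 ht₁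
    have h2 := norm_arcAvg_sub_arcAvg_le hf θ₀ ht (show t ≤ 2 * t by linarith)
    have h3 : ‖arcAvg Eb θ₀ t - c‖ ≤ 2 * κ := by
      refine le_of_mul_le_mul_left (h2.trans ?_) ht
      nlinarith
    have h4 : κ ≤ η / 16 := min_le_left _ _
    have h5 := norm_sub_norm_le (E (((1 - t : ℝ) : ℂ) * circlePt θ₀)) c
    have h6 := norm_sub_le_norm_sub_add_norm_sub (E (((1 - t : ℝ) : ℂ) * circlePt θ₀))
      (arcAvg Eb θ₀ t) c
    linarith
  have hsmall : μ (Q ∩ {z | ‖E z‖ ≤ η / 2}) ≤ ENNReal.ofReal (ε * t / 4) := by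
    refine (measure_le_of_le_norm_arcAvg_sub hC0 hC hf (c := c) (lam := η / 4) (by positivity)
      ht₄.le inter_subset_left ?_).trans (ENNReal.ofReal_le_ofReal ?_)
    · rintro z ⟨hz, hEz⟩ θ hzθ
      have h1 := hpt θ (1 - ‖z‖) (sub_pos.2 hz.1) (by linarith [norm_nonneg z])
        (by linarith [hz.2.1])
      rw [sub_sub_cancel, ← hzθ] at h1
      have h2 : ‖E z‖ ≤ η / 2 := hEz
      have h3 := norm_sub_norm_le c (E z)
      have h4 := norm_sub_le_norm_sub_add_norm_sub (E z) (arcAvg Eb θ (1 - ‖z‖)) c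
      rw [norm_sub_rev c] at h3
      linarith
    · rw [integral_arc_norm_sub_arcAvg θ₀ (by linarith : 0 < 2 * t)]
      have h1 : κ * (24 * C) ≤ ε * (η / 4) := (le_div_iff₀ (by positivity)).1 (min_le_right _ _)
      rw [div_mul_eq_mul_div, div_le_iff₀ (by positivity)]
      have h2 := mul_le_mul_of_nonneg_left hosc2 (show 0 ≤ 12 * C * Real.pi * t by positivity)
      have h3 := mul_le_mul_of_nonneg_left h1 (show 0 ≤ Real.pi * t by positivity)
      nlinarith
  have hlarge : μ (Q ∩ {z | η / 2 ≤ ‖E z‖}) ≤ ENNReal.ofReal (ε * t / 4) := by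
    have h1 : ∫⁻ z in Q, ENNReal.ofReal ‖E z‖ ∂μ ≤ ENNReal.ofReal (ε * η / 8 * t) := by
      rw [← withDensity_apply' (μ := μ)]
      exact hvQ θ₀ t ht ht₃
    have h2 := meas_ge_le_lintegral_div
      ((aemeasurable_ofReal_norm hsupp hH.1).mono_measure (Measure.restrict_le_self (s := Q)))
      (ε := ENNReal.ofReal (η / 2)) (by simpa using hη) ENNReal.ofReal_ne_top
    have h3 : μ (Q ∩ {z | η / 2 ≤ ‖E z‖}) ≤
        μ.restrict Q {z | ENNReal.ofReal (η / 2) ≤ ENNReal.ofReal ‖E z‖} := by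
      rw [inter_comm]
      exact (Measure.le_restrict_apply _ _).trans
        (measure_mono fun z hz => ENNReal.ofReal_le_ofReal hz)
    refine h3.trans (h2.trans ((ENNReal.div_le_div_right h1 _).trans (le_of_eq ?_)))
    rw [← ENNReal.ofReal_div_of_pos (by positivity)]
    congr 1
    field_simp
    norm_num
  have hsub : Q ⊆ (Q ∩ {z | ‖E z‖ ≤ η / 2}) ∪ (Q ∩ {z | η / 2 ≤ ‖E z‖}) := fun z hz =>
    (le_total ‖E z‖ (η / 2)).imp (fun h => ⟨hz, h⟩) fun h => ⟨hz, h⟩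
  have htot := hQ.trans ((measure_mono hsub).trans
    ((measure_union_le _ _).trans (add_le_add hsmall hlarge)))
  rw [← ENNReal.ofReal_add (by positivity) (by positivity),
    ENNReal.ofReal_le_ofReal_iff (by positivity)] at htot
  nlinarith [mul_pos hε ht]

end
end

section
/- Let F be an analytic self-mapping of the unit disc 𝔻. Assume that the measure |F'(z)|²(1 − |z|²)/(1 − |F(z)|²)² dA(z) is a Carleson measure on 𝔻. Then the boundary function ξ ↦ log(1 − |F(ξ)|²) on ∂𝔻, defined via the m-a.e. radial limits F(ξ) of F, is finite m-a.e. and belongs to BMO. -/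
open MeasureTheory Filter Set Topology

noncomputable section

/-- The hyperbolic density `|F'(z)|²(1-|z|²)/(1-|F(z)|²)²`. -/
def hypDensity (F : ℂ → ℂ) (z : ℂ) : ENNReal :=
  ENNReal.ofReal (‖deriv F z‖ ^ 2 * (1 - ‖z‖ ^ 2) / (1 - ‖F z‖ ^ 2) ^ 2)

open Complex Metric in
/-- Reflected Cauchy formula for the derivative. -/
lemma deriv_eq_circleIntegral_reflected {h : ℂ → ℂ} (hh : DiffContOnCl ℂ h (ball 0 1)) {z z' : ℂ}
    (hz : z ∈ ball (0 : ℂ) 1) (hz' : 1 < ‖z'‖) :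
    ∮ ζ in C(0, 1), (((ζ - z) ^ (-2 : ℤ) - (ζ - z') ^ (-2 : ℤ)) * h ζ) =
      (2 * Real.pi * I) * deriv h z := by
  have hcont : ContinuousOn h (closedBall 0 1) := by
    simpa [closure_ball] using hh.continuousOn
  have hsph : sphere (0 : ℂ) 1 ⊆ closedBall 0 1 := sphere_subset_closedBall
  have hne : ∀ ζ ∈ sphere (0 : ℂ) 1, ζ - z ≠ 0 := by
    intro ζ hζ h0
    rw [sub_eq_zero] at h0
    subst h0
    simp at hz hζ; linarith
  have hne' : ∀ ζ ∈ closedBall (0 : ℂ) 1, ζ - z' ≠ 0 := by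
    intro ζ hζ h0
    rw [sub_eq_zero] at h0
    subst h0
    simp at hζ; linarith
  have hzero : ∮ ζ in C(0, 1), ((ζ - z') ^ (-2 : ℤ) * h ζ) = 0 := by
    apply DiffContOnCl.circleIntegral_eq_zero zero_le_one
    constructor
    · intro ζ hζ
      apply DifferentiableWithinAt.mul _ (hh.differentiableOn ζ hζ)
      exact (((differentiableAt_id.sub_const z').zpow
        (Or.inl (hne' ζ (ball_subset_closedBall hζ))))).differentiableWithinAt
    · rw [closure_ball _ one_ne_zero]
      exact ((continuousOn_id.sub continuousOn_const).zpow₀ _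
        (fun ζ hζ => Or.inl (hne' ζ hζ))).mul hcont
  have hds : DiffContOnCl ℂ (dslope h z) (ball 0 1) := by
    constructor
    · exact (Complex.differentiableOn_dslope (isOpen_ball.mem_nhds hz)).2 hh.differentiableOn
    · rw [closure_ball _ one_ne_zero]
      exact (continuousOn_dslope (mem_of_superset (isOpen_ball.mem_nhds hz)
        ball_subset_closedBall)).2 ⟨hcont, hh.differentiableAt isOpen_ball hz⟩
  have hmain := hds.circleIntegral_sub_inv_smul hz
  have hc1 : ContinuousOn (fun ζ => (ζ - z) ^ (-2 : ℤ)) (sphere (0 : ℂ) 1) :=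
    (continuousOn_id.sub continuousOn_const).zpow₀ _ (fun ζ hζ => Or.inl (hne ζ hζ))
  have hc2 : ContinuousOn (fun ζ => (ζ - z') ^ (-2 : ℤ)) (sphere (0 : ℂ) 1) :=
    (continuousOn_id.sub continuousOn_const).zpow₀ _ (fun ζ hζ => Or.inl (hne' ζ (hsph hζ)))
  have hcs := hcont.mono hsph
  have e1 : ∮ ζ in C(0, 1), (ζ - z)⁻¹ • dslope h z ζ =
      ∮ ζ in C(0, 1), ((ζ - z) ^ (-2 : ℤ) * h ζ - (ζ - z) ^ (-2 : ℤ) * h z) := by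
    apply circleIntegral.integral_congr zero_le_one
    intro ζ hζ
    have h1 := hne ζ hζ
    simp only
    rw [dslope_of_ne _ (sub_ne_zero.1 h1), slope_def_field]
    simp only [smul_eq_mul, zpow_neg]
    norm_cast
    field_simp
  have i1 : CircleIntegrable (fun ζ => (ζ - z) ^ (-2 : ℤ) * h ζ) 0 1 :=
    (hc1.mul hcs).circleIntegrable zero_le_one
  have i2 : CircleIntegrable (fun ζ => (ζ - z') ^ (-2 : ℤ) * h ζ) 0 1 :=
    (hc2.mul hcs).circleIntegrable zero_le_one
  have i3 : CircleIntegrable (fun ζ => (ζ - z) ^ (-2 : ℤ) * h z) 0 1 :=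
    (hc1.mul continuousOn_const).circleIntegrable zero_le_one
  rw [e1, circleIntegral.integral_sub i1 i3] at hmain
  have e2 : ∮ ζ in C(0, 1), (ζ - z) ^ (-2 : ℤ) * h z = 0 := by
    have := circleIntegral.integral_sub_zpow_of_ne (n := -2) (by norm_num) 0 z 1
    have e := circleIntegral.integral_smul_const (fun ζ => (ζ - z) ^ (-2 : ℤ)) (h z) 0 1
    simp only [smul_eq_mul] at e
    rw [e, this, zero_mul]
  rw [e2, sub_zero, dslope_same] at hmain
  simp only [sub_mul]
  rw [circleIntegral.integral_sub i1 i2, hzero, hmain]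
  simp

open Complex Metric in
lemma integral_poissonKernel {w : ℂ} (hw : w ∈ ball (0 : ℂ) 1) :
    ∫ θ in (0 : ℝ)..2 * Real.pi, (1 - ‖w‖ ^ 2) / ‖circleMap 0 1 θ - w‖ ^ 2 = 2 * Real.pi := by
  have h := (diffContOnCl_const (𝕜 := ℂ) (c := (1 : ℂ))
    (s := ball (0 : ℂ) 1)).circleAverage_poissonKernel_smul' hw
  simp only [Real.circleAverage, sub_zero, norm_circleMap_zero, abs_one, one_pow,
    Complex.real_smul, mul_one] at h
  rw [intervalIntegral.integral_ofReal] at h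
  norm_cast at h
  have := Real.pi_pos
  field_simp at h
  linarith

open Complex in
lemma norm_reflected_kernel_le {ζ ζ₀ : ℂ} {r : ℝ} (hζ : ‖ζ‖ = 1) (hζ₀ : ‖ζ₀‖ = 1) (hr : 0 < r)
    (hr1 : r < 1) :
    ‖ζ - ζ₀‖ ≤ 2 * ‖ζ - r * ζ₀‖ ∧ 0 < ‖ζ - r * ζ₀‖ ∧
    ‖(ζ - r * ζ₀) ^ (-2 : ℤ) - (ζ - (2 - r) * ζ₀) ^ (-2 : ℤ)‖ * ‖ζ - r * ζ₀‖ ^ 4 ≤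
      4 * (1 - r) * ‖ζ - ζ₀‖ := by
  have hn : ‖(r : ℂ) * ζ₀‖ = r := by simp [hζ₀, abs_of_pos hr]
  have hlow : 1 - r ≤ ‖ζ - r * ζ₀‖ := by
    have := norm_sub_norm_le ζ (r * ζ₀)
    linarith
  have hpos : 0 < ‖ζ - r * ζ₀‖ := by linarith
  have h1 : ‖ζ - ζ₀‖ ≤ 2 * ‖ζ - r * ζ₀‖ := by
    have e : ζ - ζ₀ = (ζ - r * ζ₀) - ((1 - r : ℝ) : ℂ) * ζ₀ := by push_cast; ring
    have : ‖((1 - r : ℝ) : ℂ) * ζ₀‖ = 1 - r := by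
      rw [norm_mul, hζ₀, norm_real, Real.norm_of_nonneg (by linarith), mul_one]
    rw [e]
    linarith [norm_sub_le (ζ - r * ζ₀) (((1 - r : ℝ) : ℂ) * ζ₀)]
  have hcmp : ‖ζ - r * ζ₀‖ ≤ ‖ζ - (2 - r) * ζ₀‖ := by
    rw [← sq_le_sq₀ (norm_nonneg _) (norm_nonneg _)]
    have hre : (ζ.re * ζ₀.re + ζ.im * ζ₀.im) ≤ 1 := by
      have a1 := Complex.sq_norm ζ
      have a2 := Complex.sq_norm ζ₀
      rw [hζ, normSq_apply] at a1
      rw [hζ₀, normSq_apply] at a2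
      nlinarith [sq_nonneg (ζ.re - ζ₀.re), sq_nonneg (ζ.im - ζ₀.im)]
    have a2 := Complex.sq_norm ζ₀
    rw [hζ₀, normSq_apply] at a2
    rw [Complex.sq_norm, Complex.sq_norm, normSq_apply, normSq_apply]
    simp only [sub_re, mul_re, ofReal_re, ofReal_im, sub_im, mul_im, re_ofNat, im_ofNat]
    nlinarith
  have hpos' : 0 < ‖ζ - (2 - r) * ζ₀‖ := by linarith
  refine ⟨h1, hpos, ?_⟩
  have hA : ζ - r * ζ₀ ≠ 0 := norm_pos_iff.1 hpos
  have hB : ζ - (2 - r) * ζ₀ ≠ 0 := norm_pos_iff.1 hpos'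
  have e : (ζ - r * ζ₀) ^ (-2 : ℤ) - (ζ - (2 - r) * ζ₀) ^ (-2 : ℤ) =
      -(4 * ((1 - r : ℝ) : ℂ) * ζ₀ * (ζ - ζ₀)) / ((ζ - r * ζ₀) ^ 2 * (ζ - (2 - r) * ζ₀) ^ 2) := by
    have hz2 : ∀ x : ℂ, x ^ (-2 : ℤ) = (x ^ 2)⁻¹ := fun x => by rw [zpow_neg]; norm_cast
    rw [hz2, hz2, inv_sub_inv (pow_ne_zero 2 hA) (pow_ne_zero 2 hB)]
    congr 1
    push_cast
    ring
  have e2 : ‖((1 - r : ℝ) : ℂ)‖ = 1 - r := by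
    rw [norm_real, Real.norm_of_nonneg (by linarith)]
  rw [e, norm_div, norm_neg, norm_mul, norm_mul, norm_mul, e2, hζ₀, norm_mul, norm_pow, norm_pow]
  rw [div_mul_eq_mul_div, div_le_iff₀ (by positivity)]
  have : ‖ζ - r * ζ₀‖ ^ 4 ≤ ‖ζ - r * ζ₀‖ ^ 2 * ‖ζ - (2 - r) * ζ₀‖ ^ 2 := by
    have : ‖ζ - r * ζ₀‖ ^ 2 ≤ ‖ζ - (2 - r) * ζ₀‖ ^ 2 := by gcongr
    nlinarith [sq_nonneg ‖ζ - r * ζ₀‖]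
  simp only [norm_ofNat, mul_one]
  have h0 : 0 ≤ 4 * (1 - r) * ‖ζ - ζ₀‖ := by
    have : 0 ≤ 1 - r := by linarith
    positivity
  exact mul_le_mul_of_nonneg_left this h0

open Complex Metric in
lemma tendsto_deriv_radial_zero {h : ℂ → ℂ} (hh : DiffContOnCl ℂ h (ball 0 1)) {ζ₀ : ℂ}
    (hζ₀ : ‖ζ₀‖ = 1) {M : ℝ} (hM : ∀ ζ ∈ sphere (0 : ℂ) 1, ‖h ζ‖ ≤ M)
    (ho : ∀ ε > 0, ∃ δ > 0, ∀ ζ ∈ sphere (0 : ℂ) 1, ‖ζ - ζ₀‖ < δ → ‖h ζ‖ ≤ ε * ‖ζ - ζ₀‖) :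
    Tendsto (fun r : ℝ => deriv h (r * ζ₀)) (𝓝[<] 1) (𝓝 0) := by
  have hM0 : 0 ≤ M := (norm_nonneg _).trans (hM 1 (by simp))
  have key : ∀ ε > 0, ∃ K : ℝ, ∀ r ∈ Ioo (0 : ℝ) 1,
      ‖deriv h (r * ζ₀)‖ ≤ 16 * ε + K * (1 - r) := by
    intro ε hε
    obtain ⟨δ, hδ, hδh⟩ := ho ε hε
    refine ⟨128 * M / δ ^ 4, fun r hr => ?_⟩
    have hr0 := hr.1
    have hr1 := hr.2
    have hz : (r : ℂ) * ζ₀ ∈ ball (0 : ℂ) 1 := by simp [hζ₀, abs_of_pos hr.1, hr.2]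
    have hz' : 1 < ‖(2 - r : ℂ) * ζ₀‖ := by
      rw [norm_mul, hζ₀, mul_one]
      have : ((2 - r : ℝ) : ℂ) = 2 - r := by push_cast; ring
      rw [← this, norm_real, Real.norm_of_nonneg (by linarith)]; linarith
    have hrep := deriv_eq_circleIntegral_reflected hh hz hz'
    have hpt : ∀ ζ ∈ sphere (0 : ℂ) 1,
        ‖((ζ - r * ζ₀) ^ (-2 : ℤ) - (ζ - (2 - r) * ζ₀) ^ (-2 : ℤ)) * h ζ‖ ≤
        16 * ε * ((1 - ‖(r : ℂ) * ζ₀‖ ^ 2) / ‖ζ - r * ζ₀‖ ^ 2) + 128 * M / δ ^ 4 * (1 - r) := by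
      intro ζ hζ
      have hζ1 : ‖ζ‖ = 1 := by simpa using hζ
      obtain ⟨h1, h2, h3⟩ := norm_reflected_kernel_le hζ1 hζ₀ hr.1 hr.2
      rw [norm_mul]
      set k := ‖(ζ - r * ζ₀) ^ (-2 : ℤ) - (ζ - (2 - r) * ζ₀) ^ (-2 : ℤ)‖
      set d := ‖ζ - r * ζ₀‖
      have hn : ‖(r : ℂ) * ζ₀‖ = r := by simp [hζ₀, abs_of_pos hr.1]
      rw [hn]
      have hk : k ≤ 4 * (1 - r) * ‖ζ - ζ₀‖ / d ^ 4 := by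
        rw [le_div_iff₀ (by positivity)]; exact h3
      have h1r : 0 ≤ 1 - r := by linarith
      by_cases hlt : ‖ζ - ζ₀‖ < δ
      · have hb := hδh ζ hζ hlt
        have h4 : ‖ζ - ζ₀‖ * ‖ζ - ζ₀‖ ≤ 4 * d ^ 2 := by nlinarith [norm_nonneg (ζ - ζ₀)]
        calc k * ‖h ζ‖ ≤ (4 * (1 - r) * ‖ζ - ζ₀‖ / d ^ 4) * (ε * ‖ζ - ζ₀‖) := by gcongr
          _ = 4 * ε * (1 - r) / d ^ 4 * (‖ζ - ζ₀‖ * ‖ζ - ζ₀‖) := by ring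
          _ ≤ 4 * ε * (1 - r) / d ^ 4 * (4 * d ^ 2) := by gcongr
          _ = 16 * ε * ((1 - r) / d ^ 2) := by field_simp; ring
          _ ≤ 16 * ε * ((1 - r ^ 2) / d ^ 2) := by gcongr; nlinarith
          _ ≤ _ := by
            have : 0 ≤ 128 * M / δ ^ 4 * (1 - r) := by positivity
            linarith
      · rw [not_lt] at hlt
        have hd : δ / 2 ≤ d := by linarith
        have h2' : ‖ζ - ζ₀‖ ≤ 2 := by
          linarith [norm_sub_le ζ ζ₀]
        calc k * ‖h ζ‖ ≤ (4 * (1 - r) * 2 / (δ / 2) ^ 4) * M := by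
              refine mul_le_mul (hk.trans ?_) (hM ζ hζ) (norm_nonneg _) (by positivity)
              gcongr
          _ = 128 * M / δ ^ 4 * (1 - r) := by field_simp; ring
          _ ≤ _ := by
            have : 0 ≤ 16 * ε * ((1 - r ^ 2) / d ^ 2) := by
              have : 0 ≤ 1 - r ^ 2 := by nlinarith
              positivity
            linarith
    have hcont : Continuous fun θ => (1 - ‖(r : ℂ) * ζ₀‖ ^ 2) / ‖circleMap 0 1 θ - r * ζ₀‖ ^ 2 := by
      apply Continuous.div continuous_const (by fun_prop)
      intro θ
      have := (norm_reflected_kernel_le (ζ := circleMap 0 1 θ) (by simp) hζ₀ hr.1 hr.2).2.1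
      positivity
    have hle : ‖∮ ζ in C(0, 1), (((ζ - r * ζ₀) ^ (-2 : ℤ) - (ζ - (2 - r) * ζ₀) ^ (-2 : ℤ)) * h ζ)‖ ≤
        ∫ θ in (0 : ℝ)..2 * Real.pi,
          (16 * ε * ((1 - ‖(r : ℂ) * ζ₀‖ ^ 2) / ‖circleMap 0 1 θ - r * ζ₀‖ ^ 2) +
            128 * M / δ ^ 4 * (1 - r)) := by
      rw [circleIntegral]
      apply intervalIntegral.norm_integral_le_of_norm_le (by positivity)
      · refine Eventually.of_forall fun θ _ => ?_
        rw [norm_smul]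
        simpa using hpt (circleMap 0 1 θ) (by simp)
      · exact (Continuous.add (continuous_const.mul hcont) continuous_const).intervalIntegrable _ _
    rw [hrep, intervalIntegral.integral_add, intervalIntegral.integral_const_mul,
      integral_poissonKernel hz, intervalIntegral.integral_const, norm_mul] at hle
    · have hpi := Real.pi_pos
      have : ‖(2 * Real.pi * I : ℂ)‖ = 2 * Real.pi := by simp [abs_of_pos hpi]
      rw [this] at hle
      simp only [sub_zero, smul_eq_mul] at hle
      have h2pi : 0 < 2 * Real.pi := by positivity
      refine le_of_mul_le_mul_left (hle.trans (le_of_eq ?_)) h2pi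
      ring
    · exact (continuous_const.mul hcont).intervalIntegrable _ _
    · exact continuous_const.intervalIntegrable _ _
  rw [Metric.tendsto_nhds]
  intro η hη
  obtain ⟨K, hK⟩ := key (η / 32) (by positivity)
  have hl : Tendsto (fun r : ℝ => 16 * (η / 32) + K * (1 - r)) (𝓝[<] 1) (𝓝 (16 * (η / 32) + K * (1 - 1))) :=
    (Continuous.tendsto (by fun_prop) 1).mono_left nhdsWithin_le_nhds
  have h1 : ∀ᶠ r : ℝ in 𝓝[<] 1, r ∈ Ioo (0 : ℝ) 1 := Ioo_mem_nhdsLT one_pos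
  filter_upwards [h1, hl.eventually_lt_const (u := η) (by linarith)] with r hr hr2
  rw [dist_zero_right]
  exact (hK r hr).trans_lt hr2

lemma circlePt_ne_zero (θ : ℝ) : circlePt θ ≠ 0 := Complex.exp_ne_zero _

lemma unitDisc_eq_ball : unitDisc = Metric.ball (0 : ℂ) 1 := by
  ext z; simp [unitDisc]

lemma hasDerivAt_circlePt (θ : ℝ) :
    HasDerivAt circlePt (circlePt θ * Complex.I) θ := by
  have h := ((hasDerivAt_id θ).ofReal_comp.mul_const Complex.I).cexp
  exact h.congr_deriv (by simp [circlePt])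

lemma exists_angle_of_norm_eq_one {ζ : ℂ} (hζ : ‖ζ‖ = 1) (θ : ℝ) :
    ∃ x : ℝ, ζ = circlePt (θ + x) ∧ |x| ≤ Real.pi / 2 * ‖ζ - circlePt θ‖ := by
  refine ⟨(ζ / circlePt θ).arg, ?_, ?_⟩
  · have h1 : ‖ζ / circlePt θ‖ = 1 := by rw [norm_div, hζ, norm_circlePt, div_one]
    have h2 := Complex.norm_mul_exp_arg_mul_I (ζ / circlePt θ)
    rw [h1, Complex.ofReal_one, one_mul] at h2
    rw [circlePt, Complex.ofReal_add, add_mul, Complex.exp_add, h2]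
    change _ = circlePt θ * _
    field_simp [circlePt_ne_zero θ]
  · have hx : ‖ζ / circlePt θ‖ = 1 := by rw [norm_div, hζ, norm_circlePt, div_one]
    have h := Complex.angle_le_mul_norm_sub (x := 1) (y := ζ / circlePt θ) (by simp) hx
    rw [Complex.angle_one_left (norm_pos_iff.1 (by rw [hx]; exact one_pos)), norm_sub_rev] at h
    have e : ζ / circlePt θ - 1 = (ζ - circlePt θ) / circlePt θ := by
      field_simp [circlePt_ne_zero θ]
    rwa [e, norm_div, norm_circlePt, div_one] at h

open Complex Metric in
/-- Fatou's theorem on radial limits of bounded analytic functions. -/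
lemma ae_exists_radial_limit {F : ℂ → ℂ} (hF : DifferentiableOn ℂ F unitDisc)
    (hmap : ∀ z ∈ unitDisc, F z ∈ unitDisc) :
    ∀ᵐ θ : ℝ, ∃ l, Tendsto (fun r : ℝ => F ((r : ℂ) * circlePt θ)) (𝓝[<] 1) (𝓝 l) := by
  rw [unitDisc_eq_ball] at hF hmap
  obtain ⟨Φ, hΦ⟩ := hF.isExactOn_ball
  have hlip : LipschitzOnWith 1 Φ (ball 0 1) := by
    refine (convex_ball (0 : ℂ) 1).lipschitzOnWith_of_nnnorm_hasDerivWithin_le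
      (fun z hz => (hΦ z hz).hasDerivWithinAt) (fun z hz => ?_)
    have := hmap z hz
    rw [mem_ball_zero_iff] at this
    exact_mod_cast this.le
  obtain ⟨g, hg, hgΦ⟩ := hlip.extend_finite_dimension
  have hgd : ∀ z ∈ ball (0 : ℂ) 1, HasDerivAt g (F z) z := fun z hz =>
    (hΦ z hz).congr_of_eventuallyEq ((hgΦ.symm).eventuallyEq_of_mem (isOpen_ball.mem_nhds hz))
  have hclip : LipschitzWith 1 circlePt := by
    refine lipschitzWith_of_nnnorm_deriv_le (fun θ => (hasDerivAt_circlePt θ).differentiableAt) ?_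
    intro θ
    rw [(hasDerivAt_circlePt θ).deriv, ← NNReal.coe_le_coe]
    simp [norm_circlePt]
  filter_upwards [(hg.comp hclip).ae_differentiableAt_real] with θ hθ
  set d := deriv (g ∘ circlePt) θ
  set a := d / (circlePt θ * I)
  refine ⟨a, ?_⟩
  set h : ℂ → ℂ := fun ζ => g ζ - g (circlePt θ) - a * (ζ - circlePt θ) with hdef
  have hhd : ∀ z ∈ ball (0 : ℂ) 1, HasDerivAt h (F z - a) z := by
    intro z hz
    have := ((hgd z hz).sub_const (g (circlePt θ))).sub
      (((hasDerivAt_id z).sub_const (circlePt θ)).const_mul a)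
    exact this.congr_deriv (by simp)
  have hcont : Continuous h := by
    have := hg.continuous
    fun_prop
  have hh : DiffContOnCl ℂ h (ball 0 1) :=
    ⟨fun z hz => (hhd z hz).differentiableAt.differentiableWithinAt, hcont.continuousOn⟩
  obtain ⟨M, hM⟩ := (isCompact_sphere (0 : ℂ) 1).exists_bound_of_continuousOn hcont.continuousOn
  have hlim := tendsto_deriv_radial_zero hh (norm_circlePt θ) hM ?_
  · have := hlim.add_const a
    rw [zero_add] at this
    refine this.congr' ?_
    filter_upwards [Ioo_mem_nhdsLT (one_pos : (0 : ℝ) < 1)] with r hr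
    have hz : (r : ℂ) * circlePt θ ∈ ball (0 : ℂ) 1 := by
      simp [norm_circlePt, abs_of_pos hr.1, hr.2]
    rw [(hhd _ hz).deriv]; ring
  · intro ε hε
    have hk : HasDerivAt (fun φ => h (circlePt φ)) 0 θ := by
      have h1 := (hθ.hasDerivAt.sub_const (g (circlePt θ))).sub
        (((hasDerivAt_circlePt θ).sub_const (circlePt θ)).const_mul a)
      have h0 : a * (circlePt θ * I) = d :=
        div_mul_cancel₀ _ (mul_ne_zero (circlePt_ne_zero θ) I_ne_zero)
      rw [h0, sub_self] at h1
      exact h1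
    have hlo := hasDerivAt_iff_isLittleO_nhds_zero.1 hk
    have hpi := Real.pi_pos
    have := hlo.def (c := ε / (Real.pi / 2)) (by positivity)
    obtain ⟨δ, hδ, hδh⟩ := Metric.eventually_nhds_iff.1 this
    refine ⟨δ / (Real.pi / 2), by positivity, fun ζ hζ hd => ?_⟩
    obtain ⟨x, hx, hxle⟩ := exists_angle_of_norm_eq_one (by simpa using hζ) θ
    have hxδ : dist x 0 < δ := by
      rw [dist_zero_right, Real.norm_eq_abs]
      refine hxle.trans_lt ?_
      rw [lt_div_iff₀ (by positivity)] at hd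
      linarith
    have h2 := hδh hxδ
    rw [← hx] at h2
    have h3 : h (circlePt θ) = 0 := by simp [hdef]
    simp only [h3, sub_zero, smul_zero] at h2
    rw [Real.norm_eq_abs] at h2
    calc ‖h ζ‖ ≤ ε / (Real.pi / 2) * |x| := h2
      _ ≤ ε / (Real.pi / 2) * (Real.pi / 2 * ‖ζ - circlePt θ‖) := by gcongr
      _ = _ := by field_simp

lemma taylor_two_integral {f f₁ f₂ : ℝ → ℝ} {a b : ℝ} (hab : a ≤ b)
    (h1 : ∀ x ∈ Icc a b, HasDerivAt f (f₁ x) x) (h2 : ∀ x ∈ Icc a b, HasDerivAt f₁ (f₂ x) x)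
    (hc : ContinuousOn f₂ (Icc a b)) :
    f b = f a + (b - a) * f₁ a + ∫ x in a..b, (b - x) * f₂ x := by
  have hd : ∀ x ∈ uIcc a b, HasDerivAt (fun x => f x + (b - x) * f₁ x) ((b - x) * f₂ x) x := by
    intro x hx
    rw [uIcc_of_le hab] at hx
    have := (h1 x hx).add ((((hasDerivAt_id x).const_sub b)).mul (h2 x hx))
    exact this.congr_deriv (by simp)
  rw [intervalIntegral.integral_eq_sub_of_hasDerivAt hd]
  · ring
  · apply ContinuousOn.intervalIntegrable
    rw [uIcc_of_le hab]
    exact (continuousOn_const.sub continuousOn_id).mul hc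

lemma integrable_prod_of_continuousOn_rect {f : ℝ → ℝ → ℝ} {a b c d : ℝ}
    (hf : ContinuousOn (Function.uncurry f) (Icc a b ×ˢ Icc c d)) :
    Integrable (Function.uncurry f)
      ((volume.restrict (Ioc a b)).prod (volume.restrict (Ioc c d))) := by
  rw [Measure.prod_restrict]
  exact (hf.integrableOn_compact (isCompact_Icc.prod isCompact_Icc)).mono_set
    (prod_mono Ioc_subset_Icc_self Ioc_subset_Icc_self)

lemma intervalIntegral_swap_of_continuousOn {f : ℝ → ℝ → ℝ} {a b c d : ℝ} (hab : a ≤ b)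
    (hcd : c ≤ d) (hf : ContinuousOn (Function.uncurry f) (Icc a b ×ˢ Icc c d)) :
    ∫ y in c..d, ∫ x in a..b, f x y = ∫ x in a..b, ∫ y in c..d, f x y := by
  simp only [intervalIntegral.integral_of_le hab, intervalIntegral.integral_of_le hcd]
  exact (integral_integral_swap (integrable_prod_of_continuousOn_rect hf)).symm

/-- Quadratic bump on an interval of half-length `L`. -/
def bump (θ₀ L y : ℝ) : ℝ := 1 - ((y - θ₀) / L) ^ 2

lemma hasDerivAt_bump (θ₀ L y : ℝ) :
    HasDerivAt (bump θ₀ L) (-(2 * ((y - θ₀) / L) / L)) y := by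
  have := ((((hasDerivAt_id y).sub_const θ₀).div_const L).pow 2).const_sub 1
  exact this.congr_deriv (by simp; ring)

lemma continuous_bump (θ₀ L : ℝ) : Continuous (bump θ₀ L) :=
  continuous_iff_continuousAt.2 fun y => (hasDerivAt_bump θ₀ L y).continuousAt

lemma abs_div_le_one_of_mem {θ₀ L y : ℝ} (hL : 0 < L) (hy : y ∈ Icc (θ₀ - L) (θ₀ + L)) :
    |(y - θ₀) / L| ≤ 1 := by
  rw [abs_div, abs_of_pos hL, div_le_one hL, abs_le]
  constructor <;> linarith [hy.1, hy.2]

lemma bump_mem_Icc {θ₀ L y : ℝ} (hL : 0 < L) (hy : y ∈ Icc (θ₀ - L) (θ₀ + L)) :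
    bump θ₀ L y ∈ Icc (0 : ℝ) 1 := by
  have h := abs_div_le_one_of_mem hL hy
  rw [← sq_le_one_iff_abs_le_one] at h
  constructor
  · unfold bump; linarith
  · unfold bump; nlinarith [sq_nonneg ((y - θ₀) / L)]

/-- Local Green-type inequality on a rectangle. -/
lemma integral_bump_mul_le {V Vx Vxx Vy Vyy D : ℝ → ℝ → ℝ} {a b θ₀ L A B m : ℝ} (hab : a ≤ b)
    (hL : 0 < L) (hA : 0 ≤ A) (hB : 0 ≤ B)
    (dx : ∀ x ∈ Icc a b, ∀ y ∈ Icc (θ₀ - L) (θ₀ + L), HasDerivAt (fun x => V x y) (Vx x y) x)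
    (dxx : ∀ x ∈ Icc a b, ∀ y ∈ Icc (θ₀ - L) (θ₀ + L), HasDerivAt (fun x => Vx x y) (Vxx x y) x)
    (dyy : ∀ x ∈ Icc a b, ∀ y ∈ Icc (θ₀ - L) (θ₀ + L), HasDerivAt (Vy x) (Vyy x y) y)
    (cV : ContinuousOn (Function.uncurry V) (Icc a b ×ˢ Icc (θ₀ - L) (θ₀ + L)))
    (cVxx : ContinuousOn (Function.uncurry Vxx) (Icc a b ×ˢ Icc (θ₀ - L) (θ₀ + L)))
    (cVyy : ContinuousOn (Function.uncurry Vyy) (Icc a b ×ˢ Icc (θ₀ - L) (θ₀ + L)))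
    (cD : ContinuousOn (Function.uncurry D) (Icc a b ×ˢ Icc (θ₀ - L) (θ₀ + L)))
    (hD0 : ∀ x ∈ Icc a b, ∀ y ∈ Icc (θ₀ - L) (θ₀ + L), 0 ≤ D x y)
    (hD : ∀ x ∈ Icc a b, ∀ y ∈ Icc (θ₀ - L) (θ₀ + L), Vxx x y + Vyy x y ≤ D x y)
    (hm : ∀ x ∈ Icc a b, ∀ y ∈ Icc (θ₀ - L) (θ₀ + L), (b - x) * |Vy x y| ≤ m)
    (hVa : ∀ y ∈ Icc (θ₀ - L) (θ₀ + L), V a y ≤ A)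
    (hVxa : ∀ y ∈ Icc (θ₀ - L) (θ₀ + L), (b - a) * Vx a y ≤ B) :
    ∫ y in (θ₀ - L)..(θ₀ + L), bump θ₀ L y * V b y ≤
      2 * L * (A + B) + 4 * m * (b - a) +
        ∫ x in a..b, ∫ y in (θ₀ - L)..(θ₀ + L), (b - x) * D x y := by
  have hcd : θ₀ - L ≤ θ₀ + L := by linarith
  have ha : a ∈ Icc a b := left_mem_Icc.2 hab
  have hb : b ∈ Icc a b := right_mem_Icc.2 hab
  have slx : ∀ {f : ℝ → ℝ → ℝ},
      ContinuousOn (Function.uncurry f) (Icc a b ×ˢ Icc (θ₀ - L) (θ₀ + L)) →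
      ∀ x ∈ Icc a b, ContinuousOn (f x) (Icc (θ₀ - L) (θ₀ + L)) := fun hf x hx =>
    hf.comp (continuousOn_const.prodMk continuousOn_id) fun y hy => ⟨hx, hy⟩
  have sly : ∀ {f : ℝ → ℝ → ℝ},
      ContinuousOn (Function.uncurry f) (Icc a b ×ˢ Icc (θ₀ - L) (θ₀ + L)) →
      ∀ y ∈ Icc (θ₀ - L) (θ₀ + L), ContinuousOn (fun x => f x y) (Icc a b) := fun hf y hy =>
    hf.comp (continuousOn_id.prodMk continuousOn_const) fun x hx => ⟨hx, hy⟩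
  have cb := continuous_bump θ₀ L
  have cw : ContinuousOn (fun p : ℝ × ℝ => (b - p.1) * bump θ₀ L p.2)
      (Icc a b ×ˢ Icc (θ₀ - L) (θ₀ + L)) := by fun_prop
  set W : ℝ → ℝ → ℝ := fun x y => (b - x) * bump θ₀ L y * Vxx x y with hW
  have cW : ContinuousOn (Function.uncurry W) (Icc a b ×ˢ Icc (θ₀ - L) (θ₀ + L)) := cw.mul cVxx
  have cE : ContinuousOn (Function.uncurry fun x y => (b - x) * D x y)
      (Icc a b ×ˢ Icc (θ₀ - L) (θ₀ + L)) :=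
    ContinuousOn.mul (f := fun p : ℝ × ℝ => b - p.1) (by fun_prop) cD
  have iW := integrable_prod_of_continuousOn_rect cW
  have iE := integrable_prod_of_continuousOn_rect cE
  have itW : IntervalIntegrable (fun y => ∫ x in a..b, W x y) volume (θ₀ - L) (θ₀ + L) := by
    rw [intervalIntegrable_iff_integrableOn_Ioc_of_le hcd]
    simp only [intervalIntegral.integral_of_le hab]
    exact iW.integral_prod_right
  have step1 : ∀ y ∈ Icc (θ₀ - L) (θ₀ + L),
      bump θ₀ L y * V b y ≤ (A + B) + ∫ x in a..b, W x y := by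
    intro y hy
    have ht := taylor_two_integral hab (fun x hx => dx x hx y hy) (fun x hx => dxx x hx y hy)
      (sly cVxx y hy)
    have hbp := bump_mem_Icc hL hy
    have e : ∫ x in a..b, W x y = bump θ₀ L y * ∫ x in a..b, (b - x) * Vxx x y := by
      rw [← intervalIntegral.integral_const_mul]
      congr 1; ext x; simp only [hW]; ring
    rw [e, ht]
    have h1 := hVa y hy
    have h2 := hVxa y hy
    have : bump θ₀ L y * (V a y + (b - a) * Vx a y) ≤ A + B := by
      calc bump θ₀ L y * (V a y + (b - a) * Vx a y) ≤ bump θ₀ L y * (A + B) :=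
            mul_le_mul_of_nonneg_left (by linarith) hbp.1
        _ ≤ 1 * (A + B) := mul_le_mul_of_nonneg_right hbp.2 (by linarith)
        _ = _ := one_mul _
    linarith
  have step2 : ∫ y in (θ₀ - L)..(θ₀ + L), bump θ₀ L y * V b y ≤
      2 * L * (A + B) + ∫ y in (θ₀ - L)..(θ₀ + L), ∫ x in a..b, W x y := by
    have : ∫ y in (θ₀ - L)..(θ₀ + L), ((A + B) + ∫ x in a..b, W x y) =
        2 * L * (A + B) + ∫ y in (θ₀ - L)..(θ₀ + L), ∫ x in a..b, W x y := by
      rw [intervalIntegral.integral_add intervalIntegrable_const itW,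
        intervalIntegral.integral_const]
      simp only [smul_eq_mul]; ring
    rw [← this]
    refine intervalIntegral.integral_mono_on hcd ?_ (intervalIntegrable_const.add itW) step1
    exact ContinuousOn.intervalIntegrable (by
      rw [uIcc_of_le hcd]; exact cb.continuousOn.mul (slx cV b hb))
  have step3 : ∀ x ∈ Icc a b, ∫ y in (θ₀ - L)..(θ₀ + L), W x y ≤
      4 * m + ∫ y in (θ₀ - L)..(θ₀ + L), (b - x) * D x y := by
    intro x hx
    have hbx : 0 ≤ b - x := by linarith [hx.2]
    have i0 : IntervalIntegrable (W x) volume (θ₀ - L) (θ₀ + L) :=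
      ContinuousOn.intervalIntegrable (by rw [uIcc_of_le hcd]; exact slx cW x hx)
    have i1 : IntervalIntegrable (fun y => (b - x) * D x y) volume (θ₀ - L) (θ₀ + L) :=
      ContinuousOn.intervalIntegrable (by
        rw [uIcc_of_le hcd]; exact continuousOn_const.mul (slx cD x hx))
    have iVyy : IntervalIntegrable (Vyy x) volume (θ₀ - L) (θ₀ + L) :=
      ContinuousOn.intervalIntegrable (by rw [uIcc_of_le hcd]; exact slx cVyy x hx)
    have i2 : IntervalIntegrable (fun y => (b - x) * (bump θ₀ L y * Vyy x y)) volume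
        (θ₀ - L) (θ₀ + L) := ContinuousOn.intervalIntegrable (by
      rw [uIcc_of_le hcd]
      exact continuousOn_const.mul (cb.continuousOn.mul (slx cVyy x hx)))
    have hmono : ∫ y in (θ₀ - L)..(θ₀ + L), W x y ≤
        ∫ y in (θ₀ - L)..(θ₀ + L), ((b - x) * D x y - (b - x) * (bump θ₀ L y * Vyy x y)) := by
      refine intervalIntegral.integral_mono_on hcd i0 (i1.sub i2) fun y hy => ?_
      have hbp := bump_mem_Icc hL hy
      have h1 := hD x hx y hy
      have h0 := hD0 x hx y hy
      have h3 : bump θ₀ L y * Vxx x y ≤ D x y - bump θ₀ L y * Vyy x y := by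
        have : bump θ₀ L y * (Vxx x y + Vyy x y) ≤ 1 * D x y :=
          (mul_le_mul_of_nonneg_left h1 hbp.1).trans (mul_le_mul_of_nonneg_right hbp.2 h0)
        linarith
      calc W x y = (b - x) * (bump θ₀ L y * Vxx x y) := by simp only [hW]; ring
        _ ≤ (b - x) * (D x y - bump θ₀ L y * Vyy x y) := mul_le_mul_of_nonneg_left h3 hbx
        _ = _ := by ring
    rw [intervalIntegral.integral_sub i1 i2, intervalIntegral.integral_const_mul (b - x)
      (fun y => bump θ₀ L y * Vyy x y)] at hmono
    have hparts := intervalIntegral.integral_mul_deriv_eq_deriv_mul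
      (a := θ₀ - L) (b := θ₀ + L) (u := bump θ₀ L) (v := Vy x)
      (u' := fun y => -(2 * ((y - θ₀) / L) / L)) (v' := Vyy x)
      (fun y _ => hasDerivAt_bump θ₀ L y)
      (fun y hy => dyy x hx y (by rwa [uIcc_of_le hcd] at hy))
      (Continuous.intervalIntegrable (by fun_prop) _ _) iVyy
    have e1 : bump θ₀ L (θ₀ + L) = 0 := by simp [bump, hL.ne']
    have e2 : bump θ₀ L (θ₀ - L) = 0 := by
      have : (θ₀ - L - θ₀) / L = -1 := by field_simp; ring
      rw [bump, this]; norm_num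
    rw [e1, e2, zero_mul, zero_mul, sub_zero, zero_sub] at hparts
    have hbd : ‖(b - x) * ∫ y in (θ₀ - L)..(θ₀ + L), bump θ₀ L y * Vyy x y‖ ≤ 4 * m := by
      rw [hparts, mul_neg, norm_neg, ← intervalIntegral.integral_const_mul]
      have := intervalIntegral.norm_integral_le_of_norm_le_const (a := θ₀ - L) (b := θ₀ + L)
        (C := 2 / L * m) (f := fun y => (b - x) * (-(2 * ((y - θ₀) / L) / L) * Vy x y)) ?_
      · refine this.trans (le_of_eq ?_)
        rw [show θ₀ + L - (θ₀ - L) = 2 * L by ring, abs_of_pos (by linarith)]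
        field_simp; ring
      · intro y hy
        rw [uIoc_of_le hcd] at hy
        have hy' := Ioc_subset_Icc_self hy
        have h1 := abs_div_le_one_of_mem hL hy'
        have h2 := hm x hx y hy'
        have e : ‖(b - x) * (-(2 * ((y - θ₀) / L) / L) * Vy x y)‖ =
            2 / L * (|(y - θ₀) / L| * ((b - x) * |Vy x y|)) := by
          simp only [norm_mul, norm_neg, norm_div, Real.norm_eq_abs, abs_of_nonneg hbx,
            abs_of_pos hL, abs_two, abs_div]
          ring
        rw [e]
        have h3 : 0 ≤ (b - x) * |Vy x y| := by positivity
        have : |(y - θ₀) / L| * ((b - x) * |Vy x y|) ≤ 1 * m :=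
          mul_le_mul h1 h2 h3 zero_le_one
        rw [one_mul] at this
        gcongr
    rw [Real.norm_eq_abs, abs_le] at hbd
    linarith [hbd.1]
  rw [intervalIntegral_swap_of_continuousOn hab hcd cW] at step2
  have itW' : IntervalIntegrable (fun x => ∫ y in (θ₀ - L)..(θ₀ + L), W x y) volume a b := by
    rw [intervalIntegrable_iff_integrableOn_Ioc_of_le hab]
    simp only [intervalIntegral.integral_of_le hcd]
    exact iW.integral_prod_left
  have itE' : IntervalIntegrable (fun x => ∫ y in (θ₀ - L)..(θ₀ + L), (b - x) * D x y)
      volume a b := by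
    rw [intervalIntegrable_iff_integrableOn_Ioc_of_le hab]
    simp only [intervalIntegral.integral_of_le hcd]
    exact iE.integral_prod_left
  have step4 := intervalIntegral.integral_mono_on hab itW' (intervalIntegrable_const.add itE') step3
  rw [intervalIntegral.integral_add intervalIntegrable_const itE',
    intervalIntegral.integral_const] at step4
  simp only [smul_eq_mul] at step4
  linarith

/-- Schwarz–Pick inequality at the centre of a ball. -/
lemma norm_deriv_mul_le_one_sub_norm_sq {G : ℂ → ℂ} {w : ℂ} {R : ℝ} (hR : 0 < R)
    (hG : DifferentiableOn ℂ G (Metric.ball w R)) (hmap : ∀ z ∈ Metric.ball w R, ‖G z‖ < 1) :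
    ‖deriv G w‖ * R ≤ 1 - ‖G w‖ ^ 2 := by
  have hw : w ∈ Metric.ball w R := Metric.mem_ball_self hR
  set a := G w with ha
  have ha1 : ‖a‖ < 1 := hmap w hw
  have hNpos : 0 < 1 - ‖a‖ ^ 2 := by nlinarith [norm_nonneg a]
  have hden : ∀ z ∈ Metric.ball w R, 1 - (starRingEnd ℂ) a * G z ≠ 0 := by
    intro z hz h
    have h1 : ‖(starRingEnd ℂ) a * G z‖ = 1 := by
      rw [← sub_eq_zero.1 h, norm_one]
    rw [norm_mul, RCLike.norm_conj] at h1
    nlinarith [hmap z hz, norm_nonneg a, norm_nonneg (G z)]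
  set φ : ℂ → ℂ := fun z => (G z - a) / (1 - (starRingEnd ℂ) a * G z) with hφ
  have hφd : DifferentiableOn ℂ φ (Metric.ball w R) :=
    (hG.sub_const a).div ((hG.const_mul _).const_sub 1) hden
  have hφw : φ w = 0 := by simp [hφ, ha]
  have hφm : MapsTo φ (Metric.ball w R) (Metric.closedBall (φ w) 1) := by
    intro z hz
    rw [hφw, mem_closedBall_zero_iff, hφ, norm_div, div_le_one (norm_pos_iff.2 (hden z hz))]
    have hz1 := hmap z hz
    rw [← sq_le_sq₀ (norm_nonneg _) (norm_nonneg _)]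
    have e : ‖1 - (starRingEnd ℂ) a * G z‖ ^ 2 - ‖G z - a‖ ^ 2 =
        (1 - ‖a‖ ^ 2) * (1 - ‖G z‖ ^ 2) := by
      simp only [← Complex.normSq_eq_norm_sq, Complex.normSq_apply, Complex.sub_re, Complex.sub_im,
        Complex.mul_re, Complex.mul_im, Complex.conj_re, Complex.conj_im, Complex.one_re,
        Complex.one_im]
      ring
    have : 0 ≤ (1 - ‖a‖ ^ 2) * (1 - ‖G z‖ ^ 2) :=
      mul_nonneg hNpos.le (by nlinarith [norm_nonneg (G z)])
    linarith
  have key := Complex.norm_deriv_le_div_of_mapsTo_ball hφd hφm hR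
  have hGd := (hG.differentiableAt (Metric.isOpen_ball.mem_nhds hw)).hasDerivAt
  have hd : HasDerivAt φ (deriv G w / (1 - ‖a‖ ^ 2 : ℝ)) w := by
    have h := (hGd.sub_const a).div ((hGd.const_mul ((starRingEnd ℂ) a)).const_sub 1) (hden w hw)
    refine h.congr_deriv ?_
    have hc : (starRingEnd ℂ) a * G w = ((‖a‖ ^ 2 : ℝ) : ℂ) := by
      rw [← ha, mul_comm, Complex.mul_conj, Complex.normSq_eq_norm_sq]
    have h0 : (1 - ((‖a‖ ^ 2 : ℝ) : ℂ)) ≠ 0 := by rw [← hc]; exact hden w hw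
    simp only [← ha, sub_self, zero_mul, sub_zero] at hc ⊢
    rw [hc, Complex.ofReal_sub, Complex.ofReal_one]
    field_simp
  rw [hd.deriv, norm_div, Complex.norm_real, Real.norm_of_nonneg hNpos.le, div_le_div_iff₀ hNpos hR,
    one_mul] at key
  exact key

/-- Defect `1 - |G|²`. -/
def defect (G : ℂ → ℂ) (w : ℂ) : ℝ := 1 - ‖G w‖ ^ 2

/-- Derivative of `defect G` in the direction `e`. -/
def defectD (G : ℂ → ℂ) (e w : ℂ) : ℝ := -(2 * inner ℝ (G w) (deriv G w * e))

/-- Second derivative of `defect G` in the direction `e`. -/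
def defectDD (G : ℂ → ℂ) (e w : ℂ) : ℝ :=
  -(2 * (‖deriv G w * e‖ ^ 2 + inner ℝ (G w) (deriv (deriv G) w * e ^ 2)))

/-- Smooth version of `|log (1 - |G|²) - c|`. -/
def smoothDev (G : ℂ → ℂ) (c : ℝ) (w : ℂ) : ℝ := √(1 + (Real.log (defect G w) - c) ^ 2)

/-- Derivative of `smoothDev G c` in the direction `e`. -/
def smoothDevD (G : ℂ → ℂ) (c : ℝ) (e w : ℂ) : ℝ :=
  (Real.log (defect G w) - c) / smoothDev G c w * (defectD G e w / defect G w)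

/-- Second derivative of `smoothDev G c` in the direction `e`. -/
def smoothDevDD (G : ℂ → ℂ) (c : ℝ) (e w : ℂ) : ℝ :=
  1 / smoothDev G c w ^ 3 * (defectD G e w / defect G w) ^ 2 +
    (Real.log (defect G w) - c) / smoothDev G c w *
      (defectDD G e w / defect G w - (defectD G e w / defect G w) ^ 2)

lemma one_le_smoothDev (G : ℂ → ℂ) (c : ℝ) (w : ℂ) : 1 ≤ smoothDev G c w :=
  Real.one_le_sqrt.2 (by nlinarith [sq_nonneg (Real.log (defect G w) - c)])

lemma smoothDev_sq (G : ℂ → ℂ) (c : ℝ) (w : ℂ) :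
    smoothDev G c w ^ 2 = 1 + (Real.log (defect G w) - c) ^ 2 :=
  Real.sq_sqrt (by positivity)

lemma abs_le_smoothDev (G : ℂ → ℂ) (c : ℝ) (w : ℂ) :
    |Real.log (defect G w) - c| ≤ smoothDev G c w := by
  apply Real.abs_le_sqrt; linarith

lemma smoothDev_le (G : ℂ → ℂ) (c : ℝ) (w : ℂ) :
    smoothDev G c w ≤ 1 + |Real.log (defect G w) - c| := by
  apply Real.sqrt_le_iff.2
  refine ⟨by positivity, ?_⟩
  nlinarith [abs_nonneg (Real.log (defect G w) - c), sq_abs (Real.log (defect G w) - c)]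

lemma abs_div_smoothDev_le_one (G : ℂ → ℂ) (c : ℝ) (w : ℂ) :
    |(Real.log (defect G w) - c) / smoothDev G c w| ≤ 1 := by
  have h := one_le_smoothDev G c w
  rw [abs_div, abs_of_pos (by linarith : 0 < smoothDev G c w), div_le_one (by linarith)]
  exact abs_le_smoothDev G c w

section Calculus

variable {G : ℂ → ℂ} {U : Set ℂ}

lemma defect_pos (hmap : ∀ z ∈ U, ‖G z‖ < 1) {w : ℂ} (hw : w ∈ U) : 0 < defect G w := by
  have := hmap w hw
  unfold defect; nlinarith [norm_nonneg (G w)]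

lemma hasDerivAt_along {f : ℂ → ℂ} (hU : IsOpen U) (hf : DifferentiableOn ℂ f U) {p : ℝ → ℂ}
    {e : ℂ} {s : ℝ} (hp : HasDerivAt p e s) (hs : p s ∈ U) :
    HasDerivAt (fun s => f (p s)) (deriv f (p s) * e) s :=
  (hf.differentiableAt (hU.mem_nhds hs)).hasDerivAt.comp s hp

lemma hasDerivAt_defect (hU : IsOpen U) (hG : DifferentiableOn ℂ G U) {p : ℝ → ℂ} {e : ℂ} {s : ℝ}
    (hp : HasDerivAt p e s) (hs : p s ∈ U) :
    HasDerivAt (fun s => defect G (p s)) (defectD G e (p s)) s :=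
  ((hasDerivAt_along hU hG hp hs).norm_sq).const_sub 1

lemma hasDerivAt_defectD (hU : IsOpen U) (hG : DifferentiableOn ℂ G U) {p : ℝ → ℂ} {e : ℂ} {s : ℝ}
    (hp : HasDerivAt p e s) (hs : p s ∈ U) :
    HasDerivAt (fun s => defectD G e (p s)) (defectDD G e (p s)) s := by
  have h1 := hasDerivAt_along hU hG hp hs
  have h2 := (hasDerivAt_along hU (hG.deriv hU) hp hs).mul_const e
  have h := ((h1.inner ℝ h2).const_mul 2).neg
  refine h.congr_deriv ?_
  rw [defectDD, real_inner_self_eq_norm_sq, add_comm, mul_assoc, sq e]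

lemma hasDerivAt_log_defect (hU : IsOpen U) (hG : DifferentiableOn ℂ G U)
    (hmap : ∀ z ∈ U, ‖G z‖ < 1) {p : ℝ → ℂ} {e : ℂ} {s : ℝ}
    (hp : HasDerivAt p e s) (hs : p s ∈ U) :
    HasDerivAt (fun s => Real.log (defect G (p s))) (defectD G e (p s) / defect G (p s)) s :=
  (hasDerivAt_defect hU hG hp hs).log (defect_pos hmap hs).ne'

lemma hasDerivAt_smoothDev (hU : IsOpen U) (hG : DifferentiableOn ℂ G U)
    (hmap : ∀ z ∈ U, ‖G z‖ < 1) (c : ℝ) {p : ℝ → ℂ} {e : ℂ} {s : ℝ}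
    (hp : HasDerivAt p e s) (hs : p s ∈ U) :
    HasDerivAt (fun s => smoothDev G c (p s)) (smoothDevD G c e (p s)) s := by
  have h := ((((hasDerivAt_log_defect hU hG hmap hp hs).sub_const c).pow 2).const_add 1).sqrt
    (ne_of_gt (add_pos_of_pos_of_nonneg one_pos (sq_nonneg _)))
  refine h.congr_deriv ?_
  change _ / (2 * smoothDev G c (p s)) = _
  have h1 := one_le_smoothDev G c (p s)
  have hV : smoothDev G c (p s) ≠ 0 := by linarith
  rw [smoothDevD]
  field_simp
  simp
  ring

lemma hasDerivAt_smoothDevD (hU : IsOpen U) (hG : DifferentiableOn ℂ G U)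
    (hmap : ∀ z ∈ U, ‖G z‖ < 1) (c : ℝ) {p : ℝ → ℂ} {e : ℂ} {s : ℝ}
    (hp : HasDerivAt p e s) (hs : p s ∈ U) :
    HasDerivAt (fun s => smoothDevD G c e (p s)) (smoothDevDD G c e (p s)) s := by
  have h1 := one_le_smoothDev G c (p s)
  have hN := defect_pos hmap hs
  have hl := (hasDerivAt_log_defect hU hG hmap hp hs).sub_const c
  have h := (hl.div (hasDerivAt_smoothDev hU hG hmap c hp hs) (by linarith)).mul
    ((hasDerivAt_defectD hU hG hp hs).div (hasDerivAt_defect hU hG hp hs) hN.ne')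
  refine h.congr_deriv ?_
  have h2 := smoothDev_sq G c (p s)
  have hV : smoothDev G c (p s) ≠ 0 := by linarith
  rw [smoothDevDD, smoothDevD]
  have e1 : (defectDD G e (p s) * defect G (p s) - defectD G e (p s) * defectD G e (p s)) /
      defect G (p s) ^ 2 = defectDD G e (p s) / defect G (p s) -
        (defectD G e (p s) / defect G (p s)) ^ 2 := by field_simp
  simp only [Pi.div_apply]
  rw [e1]
  congr 1
  field_simp
  rw [h2]; ring

lemma continuousOn_defect (hG : DifferentiableOn ℂ G U) : ContinuousOn (defect G) U :=
  continuousOn_const.sub (hG.continuousOn.norm.pow 2)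

lemma continuousOn_defectD (hU : IsOpen U) (hG : DifferentiableOn ℂ G U) (e : ℂ) :
    ContinuousOn (defectD G e) U :=
  ((hG.continuousOn.inner ((hG.deriv hU).continuousOn.mul continuousOn_const)).const_smul
    (2 : ℝ)).neg

lemma continuousOn_defectDD (hU : IsOpen U) (hG : DifferentiableOn ℂ G U) (e : ℂ) :
    ContinuousOn (defectDD G e) U := by
  have h1 := (hG.deriv hU).continuousOn
  have h2 := ((hG.deriv hU).deriv hU).continuousOn
  exact ((((h1.mul continuousOn_const).norm.pow 2).add
    (hG.continuousOn.inner (h2.mul continuousOn_const))).const_smul (2 : ℝ)).neg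

lemma continuousOn_log_defect (hG : DifferentiableOn ℂ G U) (hmap : ∀ z ∈ U, ‖G z‖ < 1) :
    ContinuousOn (fun w => Real.log (defect G w)) U :=
  (continuousOn_defect hG).log fun _ hw => (defect_pos hmap hw).ne'

lemma continuousOn_smoothDev (hG : DifferentiableOn ℂ G U) (hmap : ∀ z ∈ U, ‖G z‖ < 1) (c : ℝ) :
    ContinuousOn (smoothDev G c) U :=
  (continuousOn_const.add (((continuousOn_log_defect hG hmap).sub continuousOn_const).pow 2)).sqrt

lemma continuousOn_smoothDevDD (hU : IsOpen U) (hG : DifferentiableOn ℂ G U)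
    (hmap : ∀ z ∈ U, ‖G z‖ < 1) (c : ℝ) (e : ℂ) : ContinuousOn (smoothDevDD G c e) U := by
  have cN := continuousOn_defect hG
  have hN : ∀ w ∈ U, defect G w ≠ 0 := fun w hw => (defect_pos hmap hw).ne'
  have cV := continuousOn_smoothDev hG hmap c
  have hV : ∀ w ∈ U, smoothDev G c w ≠ 0 := fun w _ => by
    have := one_le_smoothDev G c w; linarith
  have c1 := ((continuousOn_defectD hU hG e).div cN hN).pow 2
  have c2 := (continuousOn_defectDD hU hG e).div cN hN
  have c3 := ((continuousOn_log_defect hG hmap).sub (continuousOn_const (c := c))).div cV hV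
  exact ((continuousOn_const.div (cV.pow 3) fun w hw => pow_ne_zero 3 (hV w hw)).mul c1).add
    (c3.mul (c2.sub c1))

lemma smoothDevDD_add_le (hmap : ∀ z ∈ U, ‖G z‖ < 1) (c : ℝ) {w : ℂ} (hw : w ∈ U) :
    smoothDevDD G c 1 w + smoothDevDD G c Complex.I w ≤
      8 * ‖deriv G w‖ ^ 2 / defect G w ^ 2 := by
  have hN := defect_pos hmap hw
  have hV := one_le_smoothDev G c w
  have e1 : defectD G 1 w ^ 2 + defectD G Complex.I w ^ 2 = 4 * (‖G w‖ ^ 2 * ‖deriv G w‖ ^ 2) := by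
    simp only [defectD, Complex.inner, ← Complex.normSq_eq_norm_sq, Complex.normSq_apply]
    simp
    ring
  have e2 : defectDD G 1 w + defectDD G Complex.I w = -(4 * ‖deriv G w‖ ^ 2) := by
    simp only [defectDD, norm_mul, Complex.norm_I, Complex.I_sq, mul_neg, inner_neg_right,
      one_pow, mul_one]
    ring
  set u := (Real.log (defect G w) - c) / smoothDev G c w with hu
  set q := ‖deriv G w‖ ^ 2 / defect G w ^ 2 with hq
  have hq0 : 0 ≤ q := by positivity
  have e3 : (defectD G 1 w / defect G w) ^ 2 + (defectD G Complex.I w / defect G w) ^ 2 =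
      4 * ‖G w‖ ^ 2 * q := by
    rw [div_pow, div_pow, ← add_div, e1, hq]; ring
  have e4 : defectDD G 1 w / defect G w + defectDD G Complex.I w / defect G w =
      -4 * (1 - ‖G w‖ ^ 2) * q := by
    rw [← add_div, e2, hq, ← defect]; field_simp
  have e5 : smoothDevDD G c 1 w + smoothDevDD G c Complex.I w =
      1 / smoothDev G c w ^ 3 * (4 * ‖G w‖ ^ 2 * q) + u * (-4 * q) := by
    have : -4 * q = -4 * (1 - ‖G w‖ ^ 2) * q - 4 * ‖G w‖ ^ 2 * q := by ring
    rw [this, ← e3, ← e4, smoothDevDD, smoothDevDD]; ring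
  have h1 : 1 / smoothDev G c w ^ 3 ≤ 1 := by
    rw [div_le_one (by positivity)]; exact one_le_pow₀ hV
  have h2 : ‖G w‖ ^ 2 * q ≤ q :=
    mul_le_of_le_one_left hq0 (by nlinarith [hmap w hw, norm_nonneg (G w)])
  have h3 : 1 / smoothDev G c w ^ 3 * (4 * ‖G w‖ ^ 2 * q) ≤ 1 * (4 * q) :=
    mul_le_mul h1 (by linarith) (by positivity) zero_le_one
  have h4 : -1 ≤ u := (abs_le.1 (abs_div_smoothDev_le_one G c w)).1
  have h5 : 8 * ‖deriv G w‖ ^ 2 / defect G w ^ 2 = 8 * q := by rw [hq]; ring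
  rw [e5, h5]
  nlinarith

lemma abs_defectD_div_le {e w : ℂ} {R : ℝ} (he : ‖e‖ = 1) (hR : 0 < R)
    (hG : DifferentiableOn ℂ G (Metric.ball w R)) (hmap : ∀ z ∈ Metric.ball w R, ‖G z‖ < 1) :
    |defectD G e w / defect G w| ≤ 2 / R := by
  have hw := Metric.mem_ball_self (x := w) hR
  have hN := defect_pos hmap hw
  have h := norm_deriv_mul_le_one_sub_norm_sq hR hG hmap
  rw [← defect] at h
  rw [abs_div, abs_of_pos hN, div_le_div_iff₀ hN hR, defectD, abs_neg, abs_mul, abs_two]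
  have h1 : |inner ℝ (G w) (deriv G w * e)| ≤ 1 * ‖deriv G w‖ := by
    refine (abs_real_inner_le_norm _ _).trans ?_
    rw [norm_mul, he, mul_one]
    exact mul_le_mul_of_nonneg_right (hmap w hw).le (norm_nonneg _)
  nlinarith

lemma abs_smoothDevD_le {c : ℝ} {e w : ℂ} {R : ℝ} (he : ‖e‖ = 1) (hR : 0 < R)
    (hG : DifferentiableOn ℂ G (Metric.ball w R)) (hmap : ∀ z ∈ Metric.ball w R, ‖G z‖ < 1) :
    |smoothDevD G c e w| ≤ 2 / R := by
  rw [smoothDevD, abs_mul, ← one_mul (2 / R)]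
  exact mul_le_mul (abs_div_smoothDev_le_one G c w) (abs_defectD_div_le he hR hG hmap)
    (abs_nonneg _) zero_le_one

end Calculus

open Complex in
/-- Local estimate for `log (1 - |G|²)` on vertical segments of the left half plane. -/
lemma lintegral_abs_log_defect_sub_le {G : ℂ → ℂ} (hG : DifferentiableOn ℂ G {w | w.re < 0})
    (hmap : ∀ w : ℂ, w.re < 0 → ‖G w‖ < 1) {θ₀ t ε L M : ℝ} (hε : 0 < ε) (hεt : ε < t) (hL : 0 < L)
    (hM0 : 0 ≤ M)
    (hM : ∫⁻ p in Icc (-t) (-ε) ×ˢ Icc (θ₀ - L) (θ₀ + L),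
      ENNReal.ofReal (-p.1 * (‖deriv G (p.1 + p.2 * I)‖ ^ 2 / defect G (p.1 + p.2 * I) ^ 2)) ≤
        ENNReal.ofReal M) :
    ∫⁻ y in Ioo (θ₀ - L / 2) (θ₀ + L / 2), ENNReal.ofReal
      |Real.log (defect G ((-ε : ℝ) + y * I)) - Real.log (defect G ((-t : ℝ) + θ₀ * I))| ≤
        ENNReal.ofReal (4 / 3 * (2 * L * (3 + 2 / t * L) + 8 * t + 8 * M)) := by
  have ht : 0 < t := hε.trans hεt
  set c := Real.log (defect G ((-t : ℝ) + θ₀ * I)) with hc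
  set U : Set ℂ := {w | w.re < 0} with hUdef
  have hU : IsOpen U := isOpen_lt continuous_re continuous_const
  set pt : ℝ → ℝ → ℂ := fun x y => x + y * I with hpt
  have hre : ∀ x y, (pt x y).re = x := fun x y => by simp [hpt]
  have hptU : ∀ x y, x < 0 → pt x y ∈ U := fun x y hx => by
    change (pt x y).re < 0; rwa [hre]
  have hball : ∀ x y, x < 0 → Metric.ball (pt x y) (-x) ⊆ U := by
    intro x y hx z hz
    have h1 := (abs_re_le_norm (z - pt x y)).trans_lt (mem_ball_iff_norm.1 hz)
    rw [sub_re, hre, abs_lt] at h1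
    change z.re < 0
    linarith [h1.2]
  have hpx : ∀ x y, HasDerivAt (fun x => pt x y) 1 x := fun x y =>
    (ofRealCLM.hasDerivAt (x := x)).add_const _
  have hpy : ∀ x y, HasDerivAt (fun y => pt x y) I y := fun x y =>
    (((ofRealCLM.hasDerivAt (x := y)).mul_const I).const_add (x : ℂ)).congr_deriv (by simp)
  have cpt : Continuous (Function.uncurry pt) := by simp only [hpt, Function.uncurry_def]; fun_prop
  set R := Icc (-t) (-ε) ×ˢ Icc (θ₀ - L) (θ₀ + L) with hR
  have hneg : ∀ x ∈ Icc (-t) (-ε), x < 0 := fun x hx => by linarith [hx.2]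
  have cmp : ∀ {f : ℂ → ℝ}, ContinuousOn f U →
      ContinuousOn (Function.uncurry fun x y => f (pt x y)) R := fun hf =>
    hf.comp cpt.continuousOn fun p hp => hptU _ _ (hneg _ hp.1)
  set D : ℂ → ℝ := fun w => 8 * ‖deriv G w‖ ^ 2 / defect G w ^ 2 with hD
  have cD : ContinuousOn D U :=
    (continuousOn_const.mul ((hG.deriv hU).continuousOn.norm.pow 2)).div
      ((continuousOn_defect hG).pow 2) fun w hw => (pow_pos (defect_pos hmap hw) 2).ne'
  have hsub : ∀ x y, x < 0 → ∀ e : ℂ, ‖e‖ = 1 → |smoothDevD G c e (pt x y)| ≤ 2 / (-x) :=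
    fun x y hx e he => abs_smoothDevD_le he (by linarith) (hG.mono (hball x y hx))
      fun z hz => hmap z (hball x y hx hz)
  have hlog : ∀ y ∈ Icc (θ₀ - L) (θ₀ + L), |Real.log (defect G (pt (-t) y)) - c| ≤ 2 / t * L := by
    intro y hy
    have h := convex_univ.norm_image_sub_le_of_norm_hasDerivWithin_le (C := 2 / t)
      (f := fun y => Real.log (defect G (pt (-t) y)))
      (fun y _ => (hasDerivAt_log_defect hU hG hmap (hpy (-t) y)
        (hptU _ _ (by linarith))).hasDerivWithinAt) (fun y _ => ?_) (mem_univ θ₀) (mem_univ y)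
    · refine h.trans (mul_le_mul_of_nonneg_left ?_ (by positivity))
      rw [Real.norm_eq_abs, abs_le]; constructor <;> linarith [hy.1, hy.2]
    · have := abs_defectD_div_le (e := I) (G := G) (w := pt (-t) y) (R := t) norm_I ht
        (hG.mono (by simpa using hball (-t) y (by linarith)))
        fun z hz => hmap z (hball (-t) y (by linarith) (by simpa using hz))
      exact this
  have main := integral_bump_mul_le (V := fun x y => smoothDev G c (pt x y))
    (Vx := fun x y => smoothDevD G c 1 (pt x y)) (Vxx := fun x y => smoothDevDD G c 1 (pt x y))
    (Vy := fun x y => smoothDevD G c I (pt x y)) (Vyy := fun x y => smoothDevDD G c I (pt x y))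
    (D := fun x y => D (pt x y)) (a := -t) (b := -ε) (θ₀ := θ₀) (L := L)
    (A := 1 + 2 / t * L) (B := 2) (m := 2) (by linarith) hL (by positivity) (by norm_num)
    (fun x hx y _ => hasDerivAt_smoothDev hU hG hmap c (hpx x y) (hptU _ _ (hneg x hx)))
    (fun x hx y _ => hasDerivAt_smoothDevD hU hG hmap c (hpx x y) (hptU _ _ (hneg x hx)))
    (fun x hx y _ => hasDerivAt_smoothDevD hU hG hmap c (hpy x y) (hptU _ _ (hneg x hx)))
    (cmp (continuousOn_smoothDev hG hmap c)) (cmp (continuousOn_smoothDevDD hU hG hmap c 1))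
    (cmp (continuousOn_smoothDevDD hU hG hmap c I)) (cmp cD)
    (fun x hx y _ => by simp only [hD]; positivity)
    (fun x hx y _ => smoothDevDD_add_le hmap c (hptU _ _ (hneg x hx)))
    (fun x hx y _ => by
      have h0 := hneg x hx
      have h := hsub x y h0 I norm_I
      rw [le_div_iff₀ (by linarith)] at h
      nlinarith [abs_nonneg (smoothDevD G c I (pt x y)), hx.2])
    (fun y hy => (smoothDev_le G c _).trans (by linarith [hlog y hy]))
    (fun y hy => by
      have h := hsub (-t) y (by linarith) 1 norm_one
      rw [neg_neg, le_div_iff₀ ht] at h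
      have h1 := le_abs_self (smoothDevD G c 1 (pt (-t) y))
      nlinarith [abs_nonneg (smoothDevD G c 1 (pt (-t) y))])
  have hab : -t ≤ -ε := by linarith
  have hcd : θ₀ - L ≤ θ₀ + L := by linarith
  have cE : ContinuousOn (Function.uncurry fun x y => (-ε - x) * D (pt x y)) R :=
    ContinuousOn.mul (f := fun p : ℝ × ℝ => -ε - p.1) (by fun_prop) (cmp cD)
  have iE := integrable_prod_of_continuousOn_rect cE
  have harea : ∫ x in (-t)..(-ε), ∫ y in (θ₀ - L)..(θ₀ + L), (-ε - x) * D (pt x y) ≤ 8 * M := by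
    rw [intervalIntegral.integral_of_le hab]
    simp only [intervalIntegral.integral_of_le hcd]
    rw [integral_integral iE, Measure.prod_restrict]
    rw [Measure.prod_restrict] at iE
    change Integrable (fun p : ℝ × ℝ => (-ε - p.1) * D (pt p.1 p.2)) _ at iE
    rw [← ENNReal.ofReal_le_ofReal_iff (by linarith),
      ofReal_integral_eq_lintegral_ofReal iE, ENNReal.ofReal_mul (by norm_num)]
    · refine le_trans ?_ (mul_le_mul_right hM _)
      rw [← lintegral_const_mul' _ _ ENNReal.ofReal_ne_top]
      refine (lintegral_mono_set (Set.prod_mono Ioc_subset_Icc_self Ioc_subset_Icc_self)).trans ?_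
      refine lintegral_mono fun p => ?_
      rw [← ENNReal.ofReal_mul (by norm_num)]
      apply ENNReal.ofReal_le_ofReal
      have : 0 ≤ ‖deriv G (pt p.1 p.2)‖ ^ 2 / defect G (pt p.1 p.2) ^ 2 := by positivity
      calc (-ε - p.1) * D (pt p.1 p.2)
          = 8 * ((-ε - p.1) * (‖deriv G (pt p.1 p.2)‖ ^ 2 / defect G (pt p.1 p.2) ^ 2)) := by
            simp only [hD]; ring
        _ ≤ 8 * (-p.1 * (‖deriv G (pt p.1 p.2)‖ ^ 2 / defect G (pt p.1 p.2) ^ 2)) := by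
            gcongr; linarith
    · rw [EventuallyLE, ae_restrict_iff' (measurableSet_Ioc.prod measurableSet_Ioc)]
      refine ae_of_all _ fun p hp => ?_
      have h1 : 0 ≤ -ε - p.1 := by linarith [hp.1.2]
      simp only [Pi.zero_apply, hD]
      positivity
  have cBV : ContinuousOn (fun y => bump θ₀ L y * smoothDev G c (pt (-ε) y))
      (Icc (θ₀ - L) (θ₀ + L)) :=
    (continuous_bump θ₀ L).continuousOn.mul ((continuousOn_smoothDev hG hmap c).comp
      (fun y _ => (hpy (-ε) y).continuousAt.continuousWithinAt)
      fun y _ => hptU _ _ (by linarith))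
  have iBV : IntegrableOn (fun y => bump θ₀ L y * smoothDev G c (pt (-ε) y))
      (Ioc (θ₀ - L) (θ₀ + L)) :=
    (cBV.integrableOn_compact isCompact_Icc).mono_set Ioc_subset_Icc_self
  have hnn : ∀ y ∈ Ioc (θ₀ - L) (θ₀ + L), 0 ≤ bump θ₀ L y * smoothDev G c (pt (-ε) y) :=
    fun y hy => mul_nonneg (bump_mem_Icc hL (Ioc_subset_Icc_self hy)).1
      (zero_le_one.trans (one_le_smoothDev _ _ _))
  have hfin : ∫ y in (θ₀ - L)..(θ₀ + L), bump θ₀ L y * smoothDev G c (pt (-ε) y) ≤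
      2 * L * (3 + 2 / t * L) + 8 * t + 8 * M := by
    refine main.trans ?_
    have : 2 * L * (1 + 2 / t * L + 2) = 2 * L * (3 + 2 / t * L) := by ring
    linarith
  rw [intervalIntegral.integral_of_le hcd] at hfin
  refine le_trans ?_ (ENNReal.ofReal_le_ofReal (mul_le_mul_of_nonneg_left hfin (by norm_num)))
  rw [ENNReal.ofReal_mul (by norm_num), ofReal_integral_eq_lintegral_ofReal iBV
    ((ae_restrict_iff' measurableSet_Ioc).2 (ae_of_all _ hnn)),
    ← lintegral_const_mul' _ _ ENNReal.ofReal_ne_top]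
  have hsubset : Ioo (θ₀ - L / 2) (θ₀ + L / 2) ⊆ Ioc (θ₀ - L) (θ₀ + L) := fun y hy =>
    ⟨by linarith [hy.1], by linarith [hy.2]⟩
  refine le_trans (setLIntegral_mono_ae' measurableSet_Ioo (ae_of_all _ fun y hy => ?_))
    (lintegral_mono_set hsubset)
  rw [← ENNReal.ofReal_mul (by norm_num)]
  apply ENNReal.ofReal_le_ofReal
  have hb : 3 / 4 ≤ bump θ₀ L y := by
    have : |(y - θ₀) / L| ≤ 1 / 2 := by
      rw [abs_div, abs_of_pos hL, div_le_div_iff₀ hL two_pos, ← le_div_iff₀ two_pos, abs_le]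
      constructor <;> linarith [hy.1, hy.2]
    have h2 := sq_le_sq' (abs_le.1 this).1 (abs_le.1 this).2
    unfold bump; linarith
  have h1 := abs_le_smoothDev G c (pt (-ε) y)
  have h2 := one_le_smoothDev G c (pt (-ε) y)
  change |Real.log (defect G (pt (-ε) y)) - c| ≤ _
  nlinarith

lemma exp_mem_unitDisc {w : ℂ} (hw : w.re < 0) : Complex.exp w ∈ unitDisc := by
  change ‖Complex.exp w‖ < 1
  rw [Complex.norm_exp]; exact Real.exp_lt_one_iff.mpr hw

lemma differentiableOn_comp_exp {F : ℂ → ℂ} (hF : DifferentiableOn ℂ F unitDisc) :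
    DifferentiableOn ℂ (fun w => F (Complex.exp w)) {w | w.re < 0} :=
  hF.comp Complex.differentiable_exp.differentiableOn fun _ hw => exp_mem_unitDisc hw

lemma exp_ofReal_add_mul_I (x y : ℝ) :
    Complex.exp (x + y * Complex.I) = (Real.exp x : ℂ) * circlePt y := by
  rw [Complex.exp_add, circlePt, Complex.ofReal_exp]

lemma exp_mem_carlesonSquare {w : ℂ} {θ₀ t : ℝ} (h1 : -t ≤ w.re)
    (h2 : w.re < 0) (h3 : |w.im - θ₀| ≤ 2 * Real.pi * t) :
    Complex.exp w ∈ carlesonSquare θ₀ (2 * t) := by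
  refine ⟨exp_mem_unitDisc h2, ?_, w.im, by linarith, ?_⟩
  · rw [Complex.norm_exp]
    linarith [Real.add_one_le_exp w.re]
  · conv_lhs => rw [← Complex.re_add_im w, exp_ofReal_add_mul_I]
    rw [Complex.norm_exp]

lemma injOn_exp_of_abs_im_sub_lt {θ₀ : ℝ} :
    InjOn Complex.exp {w | |w.im - θ₀| < Real.pi} := by
  intro z hz w hw h
  obtain ⟨n, hn⟩ := Complex.exp_eq_exp_iff_exists_int.1 h
  have him : z.im = w.im + n * (2 * Real.pi) := by
    have := congrArg Complex.im hn
    simpa using this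
  have h1 : |(n : ℝ) * (2 * Real.pi)| < 2 * Real.pi := by
    have h2 : |z.im - θ₀| < Real.pi := hz
    have h3 : |w.im - θ₀| < Real.pi := hw
    rw [abs_lt] at h2 h3
    rw [abs_lt]; constructor <;> linarith [h2.1, h2.2, h3.1, h3.2]
  rw [abs_mul, abs_of_pos Real.two_pi_pos] at h1
  have h4 : |(n : ℝ)| < 1 := by
    by_contra! h5
    nlinarith [Real.two_pi_pos]
  have h5 : n = 0 := by
    rw [← Int.abs_lt_one_iff]; exact_mod_cast h4
  rw [hn, h5]; simp

lemma abs_det_exp_fderiv (w : ℂ) :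
    |(((1 : ℂ →L[ℂ] ℂ).smulRight (Complex.exp w)).restrictScalars ℝ).det| =
      ‖Complex.exp w‖ ^ 2 := by
  rw [ContinuousLinearMap.det]
  simp [LinearMap.det_restrictScalars, Algebra.norm_complex_eq, Complex.normSq_eq_norm_sq]

open Complex in
lemma lintegral_hypDensity_comp_exp_le {F : ℂ → ℂ} (hF : DifferentiableOn ℂ F unitDisc)
    {θ₀ t ε : ℝ} (ht : t ≤ 1 / 4) (ht0 : 0 < t)
    (hε : 0 < ε) :
    ∫⁻ p in Icc (-t) (-ε) ×ˢ Icc (θ₀ - 2 * Real.pi * t) (θ₀ + 2 * Real.pi * t),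
      ENNReal.ofReal (-p.1 * (‖deriv (fun w => F (exp w)) (p.1 + p.2 * I)‖ ^ 2 /
        defect (fun w => F (exp w)) (p.1 + p.2 * I) ^ 2)) ≤
      (volume.restrict unitDisc).withDensity (hypDensity F) (carlesonSquare θ₀ (2 * t)) := by
  set R := Icc (-t) (-ε) ×ˢ Icc (θ₀ - 2 * Real.pi * t) (θ₀ + 2 * Real.pi * t)
  set S : Set ℂ := measurableEquivRealProd ⁻¹' R with hS
  have hSm : MeasurableSet S :=
    (measurableSet_Icc.prod measurableSet_Icc).preimage measurableEquivRealProd.measurable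
  have hSmem : ∀ w ∈ S, (-t ≤ w.re ∧ w.re < 0) ∧ |w.im - θ₀| ≤ 2 * Real.pi * t := by
    intro w hw
    have h1 : w.re ∈ Icc (-t) (-ε) := hw.1
    have h2 : w.im ∈ Icc (θ₀ - 2 * Real.pi * t) (θ₀ + 2 * Real.pi * t) := hw.2
    refine ⟨⟨h1.1, by linarith [h1.2]⟩, abs_le.2 ⟨by linarith [h2.1], by linarith [h2.2]⟩⟩
  have hinj : InjOn exp S := injOn_exp_of_abs_im_sub_lt (θ₀ := θ₀).mono fun w hw =>
    (hSmem w hw).2.trans_lt (by nlinarith [Real.pi_pos])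
  have hder : ∀ w ∈ S, HasFDerivWithinAt exp
      (((1 : ℂ →L[ℂ] ℂ).smulRight (exp w)).restrictScalars ℝ) S w := fun w _ =>
    ((hasDerivAt_exp w).hasFDerivAt.restrictScalars ℝ).hasFDerivWithinAt
  have hTQ : exp '' S ⊆ carlesonSquare θ₀ (2 * t) := by
    rintro _ ⟨w, hw, rfl⟩
    obtain ⟨⟨h1, h2⟩, h3⟩ := hSmem w hw
    exact exp_mem_carlesonSquare h1 h2 h3
  have hTm : MeasurableSet (exp '' S) := measurable_image_of_fderivWithin hSm hder hinj
  calc _ = ∫⁻ w in S, ENNReal.ofReal (-w.re * (‖deriv (fun w => F (exp w)) w‖ ^ 2 /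
        defect (fun w => F (exp w)) w ^ 2)) := by
        rw [← volume_preserving_equiv_real_prod.setLIntegral_comp_preimage_emb
          measurableEquivRealProd.measurableEmbedding]
        refine lintegral_congr fun w => ?_
        simp [measurableEquivRealProd_apply, re_add_im]
    _ ≤ ∫⁻ w in S, ENNReal.ofReal
          |(((1 : ℂ →L[ℂ] ℂ).smulRight (exp w)).restrictScalars ℝ).det| *
            hypDensity F (exp w) := by
        refine setLIntegral_mono_ae' hSm (ae_of_all _ fun w hw => ?_)
        obtain ⟨⟨h1, h2⟩, h3⟩ := hSmem w hw
        have hm := exp_mem_unitDisc h2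
        have hd : deriv (fun w => F (exp w)) w = deriv F (exp w) * exp w :=
          ((hF.differentiableAt ((unitDisc_eq_ball ▸ Metric.isOpen_ball :
            IsOpen unitDisc).mem_nhds hm)).hasDerivAt.comp w (hasDerivAt_exp w)).deriv
        rw [abs_det_exp_fderiv, hypDensity, ← ENNReal.ofReal_mul (by positivity)]
        apply ENNReal.ofReal_le_ofReal
        rw [hd, defect, norm_mul, norm_exp]
        have hx : -w.re ≤ 1 - Real.exp w.re ^ 2 := by
          rw [← Real.exp_nat_mul]
          have ha : (1 - 2 * w.re) * Real.exp (2 * w.re) ≤ 1 := by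
            have := mul_le_mul_of_nonneg_right (Real.add_one_le_exp (-(2 * w.re)))
              (Real.exp_pos (2 * w.re)).le
            rw [← Real.exp_add, neg_add_cancel, Real.exp_zero] at this
            linarith
          have hb : 1 ≤ (1 - 2 * w.re) * (1 + w.re) := by nlinarith
          have hc := le_of_mul_le_mul_left (ha.trans hb) (by linarith)
          push_cast
          linarith
        calc _ = -w.re * ((Real.exp w.re ^ 2 * ‖deriv F (exp w)‖ ^ 2) /
              (1 - ‖F (exp w)‖ ^ 2) ^ 2) := by ring
          _ ≤ (1 - Real.exp w.re ^ 2) * ((Real.exp w.re ^ 2 * ‖deriv F (exp w)‖ ^ 2) /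
              (1 - ‖F (exp w)‖ ^ 2) ^ 2) := mul_le_mul_of_nonneg_right hx (by positivity)
          _ = _ := by ring
    _ = ∫⁻ z in exp '' S, hypDensity F z :=
        (lintegral_image_eq_lintegral_abs_det_fderiv_mul volume hSm hder hinj _).symm
    _ = (volume.restrict unitDisc).withDensity (hypDensity F) (exp '' S) := by
        rw [withDensity_apply _ hTm,
          Measure.restrict_restrict_of_subset (hTQ.trans fun z hz => hz.1)]
    _ ≤ _ := measure_mono hTQ

lemma exists_lintegral_log_sub_le {F : ℂ → ℂ} (hF : DifferentiableOn ℂ F unitDisc)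
    (hmap : ∀ z ∈ unitDisc, F z ∈ unitDisc)
    (hcar : IsCarleson ((volume.restrict unitDisc).withDensity (hypDensity F))) :
    ∃ K : ℝ, 0 ≤ K ∧ ∀ θ₀ t ε : ℝ, t ≤ 1 / 4 → 0 < ε → ε < t →
      ∫⁻ y in Ioo (θ₀ - Real.pi * t) (θ₀ + Real.pi * t), ENNReal.ofReal
        |Real.log (1 - ‖F ((Real.exp (-ε) : ℝ) * circlePt y)‖ ^ 2) -
          Real.log (1 - ‖F ((Real.exp (-t) : ℝ) * circlePt θ₀)‖ ^ 2)| ≤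
            ENNReal.ofReal (K * t) := by
  obtain ⟨C, hC, hQ⟩ := hcar
  refine ⟨4 / 3 * (4 * Real.pi * (3 + 4 * Real.pi) + 8 + 16 * C), by positivity,
    fun θ₀ t ε ht hε hεt => ?_⟩
  have ht0 := hε.trans hεt
  have h := lintegral_abs_log_defect_sub_le (differentiableOn_comp_exp hF)
    (fun w hw => hmap _ (exp_mem_unitDisc hw)) (θ₀ := θ₀) (L := 2 * Real.pi * t)
    (M := C * (2 * t)) hε hεt (by positivity) (by positivity)
    ((lintegral_hypDensity_comp_exp_le hF ht ht0 hε).trans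
      (hQ θ₀ (2 * t) (by linarith) (by linarith)))
  simp only [defect, exp_ofReal_add_mul_I] at h
  rw [show 2 * Real.pi * t / 2 = Real.pi * t by ring] at h
  refine h.trans (ENNReal.ofReal_le_ofReal (le_of_eq ?_))
  field_simp
  ring

lemma circlePt_add_two_pi (θ : ℝ) : circlePt (θ + 2 * Real.pi) = circlePt θ := by
  have := Complex.exp_periodic (θ * Complex.I)
  rw [circlePt, circlePt, ← this]; push_cast; ring_nf

lemma ofReal_mul_circlePt_mem_unitDisc {r : ℝ} (hr0 : 0 ≤ r) (hr : r < 1) (θ : ℝ) :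
    (r : ℂ) * circlePt θ ∈ unitDisc := by
  change ‖_‖ < 1
  rwa [norm_mul, norm_circlePt, mul_one, Complex.norm_real, Real.norm_of_nonneg hr0]

lemma continuous_comp_circlePt {F : ℂ → ℂ} (hF : DifferentiableOn ℂ F unitDisc) {r : ℝ}
    (hr0 : 0 ≤ r) (hr : r < 1) : Continuous fun θ => F ((r : ℂ) * circlePt θ) :=
  hF.continuousOn.comp_continuous (continuous_const.mul continuous_circlePt)
    fun θ => ofReal_mul_circlePt_mem_unitDisc hr0 hr θ

lemma one_sub_norm_sq_pos {F : ℂ → ℂ} (hmap : ∀ z ∈ unitDisc, F z ∈ unitDisc) {z : ℂ}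
    (hz : z ∈ unitDisc) : 0 < 1 - ‖F z‖ ^ 2 := by
  have : ‖F z‖ < 1 := hmap z hz
  nlinarith [norm_nonneg (F z)]

lemma lintegral_log_boundary_sub_le {F : ℂ → ℂ} (hF : DifferentiableOn ℂ F unitDisc)
    (hmap : ∀ z ∈ unitDisc, F z ∈ unitDisc) {Fb : ℝ → ℂ}
    (hFb : ∀ᵐ θ : ℝ, Tendsto (fun r : ℝ => F ((r : ℂ) * circlePt θ)) (𝓝[<] 1) (𝓝 (Fb θ)))
    {θ₀ t K c : ℝ} (ht : 0 < t)
    (hK : ∀ ε : ℝ, 0 < ε → ε < t →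
      ∫⁻ y in Ioo (θ₀ - Real.pi * t) (θ₀ + Real.pi * t), ENNReal.ofReal
        |Real.log (1 - ‖F ((Real.exp (-ε) : ℝ) * circlePt y)‖ ^ 2) - c| ≤ ENNReal.ofReal K) :
    (∀ᵐ y ∂(volume.restrict (Ioo (θ₀ - Real.pi * t) (θ₀ + Real.pi * t))), ‖Fb y‖ < 1) ∧
    ∫⁻ y in Ioo (θ₀ - Real.pi * t) (θ₀ + Real.pi * t), ENNReal.ofReal
        |Real.log (1 - ‖Fb y‖ ^ 2) - c| ≤ ENNReal.ofReal K := by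
  set I := Ioo (θ₀ - Real.pi * t) (θ₀ + Real.pi * t)
  set ε : ℕ → ℝ := fun n => t / (n + 2) with hε
  have hε0 : ∀ n, 0 < ε n := fun n => by positivity
  have hεt : ∀ n, ε n < t := fun n => div_lt_self ht (by linarith [n.cast_nonneg (α := ℝ)])
  have hεlim : Tendsto ε atTop (𝓝 0) :=
    tendsto_const_nhds.div_atTop (tendsto_atTop_add_const_right _ _ tendsto_natCast_atTop_atTop)
  set r : ℕ → ℝ := fun n => Real.exp (-ε n) with hr
  have hr0 : ∀ n, 0 ≤ r n := fun n => (Real.exp_pos _).le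
  have hr1 : ∀ n, r n < 1 := fun n => Real.exp_lt_one_iff.2 (neg_lt_zero.2 (hε0 n))
  have hrlim : Tendsto r atTop (𝓝[<] 1) := by
    refine tendsto_nhdsWithin_iff.2 ⟨?_, Eventually.of_forall hr1⟩
    have := (Real.continuous_exp.tendsto _).comp hεlim.neg
    rwa [neg_zero, Real.exp_zero] at this
  set g : ℕ → ℝ → ENNReal := fun n y => ENNReal.ofReal
    |Real.log (1 - ‖F ((r n : ℂ) * circlePt y)‖ ^ 2) - c| with hg
  have hgm : ∀ n, Measurable (g n) := fun n => by
    refine (ENNReal.continuous_ofReal.comp ((Continuous.sub ?_ continuous_const).abs)).measurable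
    refine Continuous.log
      (continuous_const.sub ((continuous_comp_circlePt hF (hr0 n) (hr1 n)).norm.pow 2)) fun y => ?_
    exact (one_sub_norm_sq_pos hmap (ofReal_mul_circlePt_mem_unitDisc (hr0 n) (hr1 n) y)).ne'
  have hint : ∫⁻ y in I, liminf (fun n => g n y) atTop ≤ ENNReal.ofReal K :=
    (lintegral_liminf_le hgm).trans
      (liminf_le_of_le (by isBoundedDefault) fun b hb => by
        obtain ⟨n, hn⟩ := hb.exists
        exact hn.trans (hK (ε n) (hε0 n) (hεt n)))
  have hfin : ∀ᵐ y ∂(volume.restrict I), liminf (fun n => g n y) atTop < ⊤ :=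
    ae_lt_top (Measurable.liminf hgm) (hint.trans_lt ENNReal.ofReal_lt_top).ne
  have hlt : ∀ᵐ y ∂(volume.restrict I), ‖Fb y‖ < 1 ∧
      liminf (fun n => g n y) atTop = ENNReal.ofReal |Real.log (1 - ‖Fb y‖ ^ 2) - c| := by
    filter_upwards [hfin, ae_restrict_of_ae hFb] with y hy hyF
    have h1 := hyF.comp hrlim
    have h2 : Tendsto (fun n => 1 - ‖F ((r n : ℂ) * circlePt y)‖ ^ 2) atTop
        (𝓝 (1 - ‖Fb y‖ ^ 2)) := (h1.norm.pow 2).const_sub 1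
    have hpos : ∀ n, 0 < 1 - ‖F ((r n : ℂ) * circlePt y)‖ ^ 2 := fun n =>
      one_sub_norm_sq_pos hmap (ofReal_mul_circlePt_mem_unitDisc (hr0 n) (hr1 n) y)
    have h3 : 0 ≤ 1 - ‖Fb y‖ ^ 2 := ge_of_tendsto' h2 fun n => (hpos n).le
    rcases h3.eq_or_lt with h4 | h4
    · exfalso
      rw [← h4] at h2
      have h5 : Tendsto (fun n => Real.log (1 - ‖F ((r n : ℂ) * circlePt y)‖ ^ 2)) atTop atBot :=
        Real.tendsto_log_nhdsGT_zero.comp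
          (tendsto_nhdsWithin_iff.2 ⟨h2, Eventually.of_forall hpos⟩)
      have h6 : Tendsto (fun n => g n y) atTop (𝓝 ⊤) :=
        ENNReal.tendsto_ofReal_atTop.comp
          (tendsto_abs_atBot_atTop.comp (tendsto_atBot_add_const_right _ (-c) h5))
      exact hy.ne h6.liminf_eq
    · refine ⟨?_, ?_⟩
      · rw [← abs_norm, ← sq_lt_one_iff_abs_lt_one]; linarith
      · exact (ENNReal.tendsto_ofReal ((h2.log h4.ne').sub_const c).abs).liminf_eq
  refine ⟨hlt.mono fun y hy => hy.1, ?_⟩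
  rwa [← lintegral_congr_ae (hlt.mono fun y hy => hy.2)]

lemma meanOsc_le_of_integral_le {f : ℝ → ℂ} {θ₀ t B : ℝ} (c : ℂ) (ht : 0 < t)
    (hf : IntegrableOn f (Ioo (θ₀ - Real.pi * t) (θ₀ + Real.pi * t)))
    (hB : ∫ θ in Ioo (θ₀ - Real.pi * t) (θ₀ + Real.pi * t), ‖f θ - c‖ ≤ B) :
    meanOsc f θ₀ t ≤ 2 * ((2 * Real.pi * t)⁻¹ * B) := by
  set I := Ioo (θ₀ - Real.pi * t) (θ₀ + Real.pi * t) with hI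
  set k := 2 * Real.pi * t with hk
  have hk0 : 0 < k := by positivity
  have hvol : volume.real I = k := by
    rw [hI, Real.volume_real_Ioo_of_le (by nlinarith [Real.pi_pos]), hk]; ring
  have hic : ∀ z : ℂ, IntegrableOn (fun _ : ℝ => z) I := fun z =>
    integrableOn_const (by simp [hI])
  have hfc : IntegrableOn (fun θ => f θ - c) I := hf.sub (hic c)
  have havg : arcAvg f θ₀ t - c = k⁻¹ • ∫ θ in I, (f θ - c) := by
    rw [integral_sub hf (hic c), setIntegral_const, hvol, smul_sub, smul_smul,
      inv_mul_cancel₀ hk0.ne', one_smul]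
    rfl
  have hnorm : ‖arcAvg f θ₀ t - c‖ ≤ k⁻¹ * B := by
    rw [havg, norm_smul, Real.norm_of_nonneg (by positivity)]
    gcongr
    exact (norm_integral_le_integral_norm _).trans hB
  have hint : ∫ θ in I, ‖f θ - arcAvg f θ₀ t‖ ≤ 2 * B := by
    calc ∫ θ in I, ‖f θ - arcAvg f θ₀ t‖ ≤ ∫ θ in I, (‖f θ - c‖ + k⁻¹ * B) := by
          refine integral_mono (hf.sub (hic _)).norm
            (hfc.norm.add (integrableOn_const (by simp [hI]))) fun θ => ?_
          have : f θ - arcAvg f θ₀ t = (f θ - c) - (arcAvg f θ₀ t - c) := by ring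
          change ‖f θ - arcAvg f θ₀ t‖ ≤ _
          rw [this]
          exact (norm_sub_le _ _).trans (by linarith)
      _ ≤ 2 * B := by
          rw [integral_add hfc.norm (integrableOn_const (by simp [hI])), setIntegral_const, hvol,
            smul_eq_mul, mul_inv_cancel_left₀ hk0.ne']
          linarith
  calc meanOsc f θ₀ t = k⁻¹ * ∫ θ in I, ‖f θ - arcAvg f θ₀ t‖ := rfl
    _ ≤ k⁻¹ * (2 * B) := by gcongr
    _ = _ := by ring

/-- Lemma 2.5(a): if `F` is an analytic self-map of the disc and
`|F'(z)|²(1-|z|²)/(1-|F(z)|²)² dA(z)` is a Carleson measure, then the boundary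
function `log(1-|F|²)` (defined via the a.e. radial limits of `F`) is finite a.e.
and belongs to BMO. -/
theorem stmt_9 (F : ℂ → ℂ) (hF : DifferentiableOn ℂ F unitDisc)
    (hmap : ∀ z ∈ unitDisc, F z ∈ unitDisc)
    (hcar : IsCarleson ((volume.restrict unitDisc).withDensity (hypDensity F))) :
    ∃ Fb : ℝ → ℂ, HasRadialLimits F Fb ∧
      (∀ᵐ θ ∂(volume.restrict (Set.Ioc 0 (2 * Real.pi))), ‖Fb θ‖ < 1) ∧
      IsBMO (fun θ => ((Real.log (1 - ‖Fb θ‖ ^ 2) : ℝ) : ℂ)) := by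
  obtain ⟨K, hK0, hK⟩ := exists_lintegral_log_sub_le hF hmap hcar
  set Fb : ℝ → ℂ := fun θ => limUnder (𝓝[<] 1) fun r : ℝ => F ((r : ℂ) * circlePt θ) with hFbdef
  have hFb : ∀ᵐ θ : ℝ, Tendsto (fun r : ℝ => F ((r : ℂ) * circlePt θ)) (𝓝[<] 1) (𝓝 (Fb θ)) :=
    (ae_exists_radial_limit hF hmap).mono fun θ hθ => tendsto_nhds_limUnder hθ
  set f : ℝ → ℂ := fun θ => ((Real.log (1 - ‖Fb θ‖ ^ 2) : ℝ) : ℂ) with hf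
  have hper : Function.Periodic f (2 * Real.pi) := fun θ => by
    simp only [hf, hFbdef, circlePt_add_two_pi]
  have hloc : ∀ θ₀ t : ℝ, 0 < t → t ≤ 1 / 4 → ∃ c : ℝ,
      (∀ᵐ y ∂(volume.restrict (Ioo (θ₀ - Real.pi * t) (θ₀ + Real.pi * t))), ‖Fb y‖ < 1) ∧
      ∫⁻ y in Ioo (θ₀ - Real.pi * t) (θ₀ + Real.pi * t), ‖f y - c‖ₑ ≤ ENNReal.ofReal (K * t) := by
    intro θ₀ t ht ht4
    have h := lintegral_log_boundary_sub_le hF hmap hFb ht fun ε hε hεt => hK θ₀ t ε ht4 hε hεt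
    refine ⟨Real.log (1 - ‖F ((Real.exp (-t) : ℝ) * circlePt θ₀)‖ ^ 2), h.1,
      (lintegral_congr fun y => ?_).trans_le h.2⟩
    rw [← Complex.ofReal_sub, ← ofReal_norm, Complex.norm_real, Real.norm_eq_abs]
  have hFbm : AEStronglyMeasurable Fb volume := by
    set r : ℕ → ℝ := fun n => 1 - 1 / (n + 1) with hr
    have hr0 : ∀ n, 0 ≤ r n := fun n => by
      have := n.cast_nonneg (α := ℝ)
      simp only [hr, sub_nonneg]
      rw [div_le_one (by positivity)]
      linarith
    have hr1 : ∀ n, r n < 1 := fun n => sub_lt_self _ (by positivity)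
    have hrlim : Tendsto r atTop (𝓝[<] 1) := by
      refine tendsto_nhdsWithin_iff.2 ⟨?_, Eventually.of_forall hr1⟩
      have := (tendsto_one_div_add_atTop_nhds_zero_nat (𝕜 := ℝ)).const_sub 1
      rwa [sub_zero] at this
    exact aestronglyMeasurable_of_tendsto_ae atTop
      (fun n => (continuous_comp_circlePt hF (hr0 n) (hr1 n)).aestronglyMeasurable)
      (hFb.mono fun θ hθ => hθ.comp hrlim)
  have hfm : AEStronglyMeasurable f volume :=
    (Complex.measurable_ofReal.comp_aemeasurable
      (Real.measurable_log.comp_aemeasurable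
        ((hFbm.norm.aemeasurable.pow_const 2).const_sub 1))).aestronglyMeasurable
  have hfint : ∀ θ₀ t : ℝ, 0 < t → t ≤ 1 / 4 →
      IntegrableOn f (Ioo (θ₀ - Real.pi * t) (θ₀ + Real.pi * t)) := by
    intro θ₀ t ht ht4
    obtain ⟨c, -, hc⟩ := hloc θ₀ t ht ht4
    have h1 : IntegrableOn (fun y => f y - c) (Ioo (θ₀ - Real.pi * t) (θ₀ + Real.pi * t)) :=
      ⟨(hfm.sub aestronglyMeasurable_const).restrict, hc.trans_lt ENNReal.ofReal_lt_top⟩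
    have h2 : IntegrableOn (fun _ : ℝ => (c : ℂ)) (Ioo (θ₀ - Real.pi * t) (θ₀ + Real.pi * t)) :=
      integrableOn_const (by simp)
    exact (h1.add h2).congr (ae_of_all _ fun y => by simp)
  have hpi4 : 1 / 2 < Real.pi * (1 / 4) := by linarith [Real.pi_gt_three]
  have hlocint : LocallyIntegrable f volume := fun θ =>
    ⟨_, Ioo_mem_nhds (by linarith) (by linarith), hfint θ (1 / 4) (by norm_num) le_rfl⟩
  have hlt : ∀ᵐ θ : ℝ, ‖Fb θ‖ < 1 := by
    have h : ∀ᵐ θ : ℝ, ∀ n : ℤ,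
        θ ∈ Ioo ((n : ℝ) - Real.pi * (1 / 4)) (n + Real.pi * (1 / 4)) → ‖Fb θ‖ < 1 := by
      refine ae_all_iff.2 fun n => (ae_restrict_iff' measurableSet_Ioo).1 ?_
      obtain ⟨c, hc, -⟩ := hloc n (1 / 4) (by norm_num) le_rfl
      exact hc
    filter_upwards [h] with θ hθ
    have h1 := abs_le.1 (abs_sub_round θ)
    exact hθ (round θ) ⟨by linarith [h1.1], by linarith [h1.2]⟩
  refine ⟨Fb, ae_restrict_of_ae hFb, ae_restrict_of_ae hlt, hper,
    (hlocint.integrableOn_isCompact isCompact_Icc).mono_set Ioc_subset_Icc_self,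
    max (2 * (K / (2 * Real.pi)))
      (2 * ((Real.pi / 2)⁻¹ * ∫ θ in (0 : ℝ)..(0 + 2 * Real.pi), ‖f θ‖)), fun θ₀ t ht ht1 => ?_⟩
  have hIint : IntegrableOn f (Ioo (θ₀ - Real.pi * t) (θ₀ + Real.pi * t)) :=
    (hlocint.integrableOn_isCompact isCompact_Icc).mono_set Ioo_subset_Icc_self
  rcases le_or_gt t (1 / 4) with h4 | h4
  · obtain ⟨c, -, hc⟩ := hloc θ₀ t ht h4
    refine le_max_of_le_left ((meanOsc_le_of_integral_le c ht hIint (B := K * t) ?_).trans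
      (le_of_eq ?_))
    · rw [integral_norm_eq_lintegral_enorm (f := fun y => f y - c) ((hfm.sub aestronglyMeasurable_const).restrict)]
      exact ENNReal.toReal_le_of_le_ofReal (by positivity) hc
    · field_simp
  · refine le_max_of_le_right ((meanOsc_le_of_integral_le 0 ht hIint
      (B := ∫ θ in (0 : ℝ)..(0 + 2 * Real.pi), ‖f θ‖) ?_).trans ?_)
    · have hp : Function.Periodic (fun θ => ‖f θ‖) (2 * Real.pi) := fun θ => by
        simp only [hper θ]
      rw [← hp.intervalIntegral_add_eq (θ₀ - Real.pi) 0,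
        intervalIntegral.integral_of_le (by linarith [Real.pi_pos])]
      simp only [sub_zero]
      refine setIntegral_mono_set
        (((hlocint.integrableOn_isCompact isCompact_Icc).mono_set Ioc_subset_Icc_self).norm)
        (ae_of_all _ fun θ => norm_nonneg _) (ae_of_all _ fun θ hθ => ?_)
      have : Real.pi * t ≤ Real.pi := mul_le_of_le_one_right Real.pi_pos.le ht1
      exact ⟨by linarith [hθ.1], by linarith [hθ.2]⟩
    · have h0 : 0 ≤ ∫ θ in (0 : ℝ)..(0 + 2 * Real.pi), ‖f θ‖ :=
        intervalIntegral.integral_nonneg (by linarith [Real.pi_pos]) fun θ _ => norm_nonneg _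
      gcongr
      nlinarith [Real.pi_pos]
end
end
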